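/- arXiv:math/0410476 — 2 statements merged into one kernel-verified Lean document; each statement's English description precedes it below -/
import Mathlib

section
/- Let n ≥ 1 and let f : S^n → S^{n+1} be a continuous map whose set of injectivity I contains the closed metric ball D := {x ∈ S^n : |x − x₀| ≤ r} for some x₀ ∈ S^n and 0 < r < 1, and let U₁, U₂ be the two connected components of S^{n+1} \ f(S^n) whose closures intersect f(D°). Then every point of f(D°) lies in the closure of U₁ and in the closure of U₂. -/
/-- `C` is a connected component of the subset `S` of a topological space. -/
def IsConnCompIn {α : Type*} [TopologicalSpace α] (S C : Set α) : Prop :=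
  ∃ x ∈ S, C = connectedComponentIn S x

section Auxiliary

open MeasureTheory Polynomial
open scoped NNReal RealInnerProductSpace

section NoRetraction

variable {E : Type*} [NormedAddCommGroup E] [NormedSpace ℝ E]

theorem exists_polynomial_eval_eq_det_id_add_smul [FiniteDimensional ℝ E] (A : E →L[ℝ] E) :
    ∃ P : ℝ[X], P.natDegree ≤ Module.finrank ℝ E ∧
      ∀ t : ℝ, P.eval t = (ContinuousLinearMap.id ℝ E + t • A).det := by
  classical
  let b := Module.finBasis ℝ E
  let M := LinearMap.toMatrix b b (A : E →ₗ[ℝ] E)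
  refine ⟨Matrix.det ((X : ℝ[X]) • M.map C + (1 : Matrix _ _ ℝ).map C), ?_, fun t ↦ ?_⟩
  · simpa using Polynomial.natDegree_det_X_add_C_le M 1
  · rw [ContinuousLinearMap.det, ← LinearMap.det_toMatrix b, ← coe_evalRingHom, RingHom.map_det]
    congr 1
    ext i j
    simp [M, LinearMap.toMatrix_apply, Matrix.one_apply, Module.Basis.repr_self,
      Finsupp.single_apply, eq_comm (a := j)]
    split_ifs <;> simp <;> ring

theorem det_id_add_pos [FiniteDimensional ℝ E] {A : E →L[ℝ] E} (hA : ‖A‖ < 1) :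
    0 < (ContinuousLinearMap.id ℝ E + A).det := by
  have hne : ∀ s ∈ Set.Icc (0 : ℝ) 1, (ContinuousLinearMap.id ℝ E + s • A).det ≠ 0 := by
    intro s hs h0
    obtain ⟨v, hv, hv0⟩ := Submodule.exists_mem_ne_zero_of_ne_bot
      (LinearMap.bot_lt_ker_of_det_eq_zero h0).ne'
    have h1 : v = -(s • A v) := by
      rw [LinearMap.mem_ker] at hv
      exact eq_neg_of_add_eq_zero_left (by simpa using hv)
    have h2 : ‖v‖ ≤ ‖A‖ * ‖v‖ := by
      calc ‖v‖ = s * ‖A v‖ := by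
            conv_lhs => rw [h1, norm_neg, norm_smul, Real.norm_of_nonneg hs.1]
        _ ≤ 1 * ‖A v‖ := by gcongr; exact hs.2
        _ ≤ ‖A‖ * ‖v‖ := by simpa using A.le_opNorm v
    have := norm_pos_iff.2 hv0
    nlinarith
  by_contra! hneg
  have hc : ContinuousOn (fun s : ℝ ↦ (ContinuousLinearMap.id ℝ E + s • A).det)
      (Set.Icc 0 1) :=
    (ContinuousLinearMap.continuous_det.comp (by fun_prop)).continuousOn
  obtain ⟨s, hs, h0⟩ := intermediate_value_Icc' zero_le_one hc
    (show (0 : ℝ) ∈ Set.Icc _ _ from ⟨by simpa using hneg, by simp [ContinuousLinearMap.det]⟩)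
  exact hne s hs h0

/-- A Lipschitz function on a closed ball that vanishes on the sphere, extended by zero. -/
theorem LipschitzOnWith.extend_zero_closedBall {u : E → E} {R : ℝ} {L : ℝ≥0}
    (hu : LipschitzOnWith L u (Metric.closedBall 0 R)) (h0 : ∀ x, ‖x‖ = R → u x = 0) :
    LipschitzWith L (fun x ↦ open Classical in if ‖x‖ ≤ R then u x else 0) := by
  classical
  have key : ∀ x y : E, ‖x‖ ≤ R → ¬ ‖y‖ ≤ R → ‖u x‖ ≤ L * ‖x - y‖ := by
    intro x y hx hy
    have hc : ContinuousOn (fun s : ℝ ↦ ‖AffineMap.lineMap x y s‖) (Set.Icc 0 1) :=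
      (AffineMap.lineMap_continuous.norm).continuousOn
    obtain ⟨s, hs, hsR⟩ := intermediate_value_Icc zero_le_one hc
      (show R ∈ Set.Icc _ _ from ⟨by simpa using hx, by simpa using (not_le.1 hy).le⟩)
    have h1 := hu.dist_le_mul x (by simpa using hx) (AffineMap.lineMap x y s)
      (by simpa using hsR.le)
    rw [h0 _ hsR, dist_zero_right, dist_left_lineMap, Real.norm_of_nonneg hs.1, dist_eq_norm] at h1
    refine h1.trans ?_
    gcongr
    exact mul_le_of_le_one_left (norm_nonneg _) hs.2
  refine LipschitzWith.of_dist_le_mul fun x y ↦ ?_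
  by_cases hx : ‖x‖ ≤ R <;> by_cases hy : ‖y‖ ≤ R <;> simp only [hx, hy, if_true, if_false]
  · exact hu.dist_le_mul x (by simpa using hx) y (by simpa using hy)
  · simpa [dist_eq_norm] using key x y hx hy
  · simpa [dist_eq_norm, norm_sub_rev] using key y x hy hx
  · simp; positivity

theorem bijOn_closedBall_add_smul [FiniteDimensional ℝ E] {u : E → E} {R : ℝ} {L : ℝ≥0}
    (hu : LipschitzWith L u) (h0 : ∀ x, R < ‖x‖ → u x = 0) {t : ℝ} (ht : 0 ≤ t)
    (htL : t * L < 1) :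
    Set.BijOn (fun x ↦ x + t • u x) (Metric.closedBall 0 R) (Metric.closedBall 0 R) := by
  have hbij : ∀ v : E, ∃! x, x + t • u x = v := by
    intro v
    have hK : ContractingWith (Real.toNNReal t * L) (fun x ↦ v - t • u x) := by
      refine ⟨?_, LipschitzWith.of_dist_le_mul fun x y ↦ ?_⟩
      · rw [← NNReal.coe_lt_coe]
        simpa [ht] using htL
      · have := hu.dist_le_mul x y
        rw [dist_sub_left, dist_smul₀, Real.norm_of_nonneg ht]
        simp only [NNReal.coe_mul, Real.coe_toNNReal _ ht, mul_assoc]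
        gcongr
    refine ⟨ContractingWith.fixedPoint _ hK, ?_, fun y hy ↦ ?_⟩
    · have := hK.fixedPoint_isFixedPt
      simp only [Function.IsFixedPt] at this
      exact (eq_sub_iff_add_eq.1 this.symm)
    · exact hK.fixedPoint_unique (sub_eq_iff_eq_add.2 hy.symm)
  refine ⟨fun x hx ↦ ?_, fun x _ y _ hxy ↦ (hbij _).unique hxy rfl, fun v hv ↦ ?_⟩
  · by_contra hout
    have hout' : R < ‖x + t • u x‖ := by simpa using hout
    have heq := (hbij (x + t • u x)).unique (y₁ := x) (y₂ := x + t • u x) rfl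
      (by rw [h0 _ hout']; simp)
    rw [← heq] at hout'
    exact absurd hout' (by simpa using hx)
  · obtain ⟨x, hx, -⟩ := hbij v
    refine ⟨x, ?_, hx⟩
    by_contra hout
    rw [h0 x (by simpa using hout)] at hx
    simp only [smul_zero, add_zero] at hx
    exact hout (hx ▸ hv)

theorem det_fderiv_eq_zero_of_norm_eq {E : Type*} [NormedAddCommGroup E] [InnerProductSpace ℝ E]
    [FiniteDimensional ℝ E] {f : E → E} {R : ℝ} (hR : 0 < R) (hf : Differentiable ℝ f)
    (hn : ∀ x, ‖f x‖ = R) (x : E) : (fderiv ℝ f x).det = 0 := by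
  by_contra hdet
  obtain ⟨v, hv⟩ := (LinearMap.equivOfDetNeZero _ hdet).surjective (f x)
  have hv : fderiv ℝ f x v = f x := hv
  have h1 : HasFDerivAt (fun y ↦ ⟪f y, f y⟫) _ x := (hf x).hasFDerivAt.inner ℝ (hf x).hasFDerivAt
  have h2 : HasFDerivAt (fun y ↦ ⟪f y, f y⟫) (0 : E →L[ℝ] ℝ) x := by
    simp only [real_inner_self_eq_norm_sq, hn]
    exact hasFDerivAt_const _ _
  have h3 := congrArg (fun l : E →L[ℝ] ℝ ↦ l v) (h1.unique h2)
  simp [fderivInnerCLM_apply, hv, hn] at h3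
  exact hR.ne' h3

theorem no_contDiff_retraction_closedBall {E : Type*} [NormedAddCommGroup E]
    [InnerProductSpace ℝ E] [FiniteDimensional ℝ E] {f : E → E} {R : ℝ} (hR : 0 < R)
    (hf : ContDiff ℝ 1 f) (hn : ∀ x, ‖f x‖ = R) (hfix : ∀ x, ‖x‖ = R → f x = x) : False := by
  classical
  borelize E
  let μ : Measure E := Measure.addHaar
  let B : Set E := Metric.closedBall 0 R
  have hBc : IsCompact B := isCompact_closedBall 0 R
  let A : E → E →L[ℝ] E := fun x ↦ fderiv ℝ f x - ContinuousLinearMap.id ℝ E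
  have hAc : Continuous A := (hf.continuous_fderiv one_ne_zero).sub continuous_const
  have hdu : ∀ x, HasFDerivAt (fun x ↦ f x - x) (A x) x := fun x ↦
    ((hf.differentiable one_ne_zero) x).hasFDerivAt.sub (hasFDerivAt_id x)
  obtain ⟨C, hC⟩ := hBc.exists_bound_of_continuousOn hAc.continuousOn
  let L : ℝ≥0 := Real.toNNReal C + 1
  have hL : ∀ x ∈ B, ‖A x‖ ≤ L := fun x hx ↦ by
    have h1 := Real.le_coe_toNNReal C
    have h2 := hC x hx
    simp only [L, NNReal.coe_add, NNReal.coe_one]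
    linarith
  have hL0 : (0 : ℝ) < L := by positivity
  have hLip : LipschitzOnWith L (fun x ↦ f x - x) B := by
    refine Convex.lipschitzOnWith_of_nnnorm_hasFDerivWithin_le (𝕜 := ℝ) (f' := A)
      (fun x _ ↦ (hdu x).hasFDerivWithinAt) (fun x hx ↦ ?_) (convex_closedBall 0 R)
    exact_mod_cast hL x hx
  have hLip' := LipschitzOnWith.extend_zero_closedBall hLip
    (fun x hx ↦ by simp [hfix x hx])
  have hvol : ∀ t : ℝ, 0 ≤ t → t * L < 1 →
      ∫ x in B, (ContinuousLinearMap.id ℝ E + t • A x).det ∂μ = μ.real B := by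
    intro t ht htL
    have hbij := bijOn_closedBall_add_smul hLip' (R := R)
      (fun x hx ↦ if_neg (not_le.2 hx)) ht htL
    have hbij' : Set.BijOn (fun x ↦ x + t • (f x - x)) B B := by
      refine hbij.congr fun x hx ↦ ?_
      have : ‖x‖ ≤ R := by simpa using hx
      simp [this]
    have := integral_image_eq_integral_abs_det_fderiv_smul μ hBc.measurableSet
      (f := fun x ↦ x + t • (f x - x))
      (f' := fun x ↦ ContinuousLinearMap.id ℝ E + t • A x)
      (fun x _ ↦ ((hasFDerivAt_id x).add ((hdu x).const_smul t)).hasFDerivWithinAt)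
      hbij'.injOn (fun _ ↦ (1 : ℝ))
    rw [hbij'.image_eq] at this
    simp only [integral_const, smul_eq_mul, mul_one, measureReal_restrict_apply_univ] at this
    rw [this]
    refine setIntegral_congr_fun hBc.measurableSet fun x hx ↦ ?_
    refine (abs_of_pos (det_id_add_pos ?_)).symm
    rw [norm_smul, Real.norm_of_nonneg ht]
    exact (mul_le_mul_of_nonneg_left (hL x hx) ht).trans_lt htL
  have hdet_cont : ∀ c : ℝ, Continuous fun x ↦ (ContinuousLinearMap.id ℝ E + c • A x).det :=
    fun c ↦ ContinuousLinearMap.continuous_det.comp (continuous_const.add (hAc.const_smul c))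
  let d := Module.finrank ℝ E
  let s := Finset.range (d + 1)
  let v : ℕ → ℝ := fun i ↦ i / ((d + 1) * L)
  have hv : Set.InjOn v s := by
    intro i _ j _ hij
    have : ((d + 1) * L : ℝ) ≠ 0 := by positivity
    simpa [v, div_left_inj' this] using hij
  have hv0 : ∀ i, 0 ≤ v i := fun i ↦ by positivity
  have hv1 : ∀ i ∈ s, v i * L < 1 := by
    intro i hi
    have hi' : (i : ℝ) < d + 1 := by exact_mod_cast Finset.mem_range.1 hi
    simp only [v]
    rw [div_mul_eq_mul_div, div_lt_one (by positivity)]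
    gcongr
  have hinterp : ∀ x, (fderiv ℝ f x).det = ∑ i ∈ s,
      (ContinuousLinearMap.id ℝ E + v i • A x).det * (Lagrange.basis s v i).eval 1 := by
    intro x
    obtain ⟨P, hP, hPe⟩ := exists_polynomial_eval_eq_det_id_add_smul (A x)
    have h1 : P.degree < s.card := by
      refine lt_of_le_of_lt (Polynomial.degree_le_of_natDegree_le hP) ?_
      simp only [s, Finset.card_range]
      exact_mod_cast Nat.lt_succ_self _
    have h2 := congrArg (Polynomial.eval 1) (Lagrange.eq_interpolate hv h1)
    rw [hPe, Lagrange.interpolate_apply, Polynomial.eval_finsetSum] at h2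
    simp only [Polynomial.eval_mul, Polynomial.eval_C, hPe] at h2
    rw [← h2]
    simp [A]
  have hsum : ∑ i ∈ s, (Lagrange.basis s v i).eval 1 = 1 := by
    rw [← Polynomial.eval_finsetSum, Lagrange.sum_basis hv ⟨0, by simp [s]⟩, Polynomial.eval_one]
  have hzero : ∫ x in B, (fderiv ℝ f x).det ∂μ = 0 := by
    simp [det_fderiv_eq_zero_of_norm_eq hR (hf.differentiable one_ne_zero) hn]
  have hone : ∫ x in B, (fderiv ℝ f x).det ∂μ = μ.real B := by
    simp_rw [hinterp]
    rw [integral_finsetSum]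
    · calc _ = ∑ i ∈ s, μ.real B * (Lagrange.basis s v i).eval 1 := by
            refine Finset.sum_congr rfl fun i hi ↦ ?_
            rw [integral_mul_const, hvol _ (hv0 i) (hv1 i hi)]
        _ = μ.real B := by rw [← Finset.mul_sum, hsum, mul_one]
    · intro i _
      exact ((hdet_cont _).continuousOn.integrableOn_compact hBc).mul_const _
  have hpos : 0 < μ.real B := ENNReal.toReal_pos
    (Metric.measure_closedBall_pos μ 0 hR).ne' hBc.measure_lt_top.ne
  linarith

/-- A continuous self-map of Euclidean space that is the identity near infinity has a zero. -/
theorem exists_eq_zero_of_eq_self_of_norm_ge {E : Type*} [NormedAddCommGroup E]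
    [InnerProductSpace ℝ E] [FiniteDimensional ℝ E] {g : E → E} (hg : Continuous g) {R : ℝ}
    (hfix : ∀ x, R ≤ ‖x‖ → g x = x) : ∃ x, g x = 0 := by
  by_contra! hne
  let R' := max R 0 + 1
  have hR' : 0 < R' := by positivity
  have hRR' : R < R' := (le_max_left R 0).trans_lt (lt_add_one _)
  obtain ⟨h, hh, happ, heq, -⟩ := hg.exists_contDiff_approx_and_eqOn 1 (ε := fun x ↦ ‖g x‖)
    hg.norm (fun x ↦ norm_pos_iff.2 (hne x)) (S := {x | R' ≤ ‖x‖}) (U := {x | R < ‖x‖})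
    (isClosed_le continuous_const continuous_norm)
    ((isOpen_lt continuous_const continuous_norm).mem_nhdsSet.2
      fun x (hx : R' ≤ ‖x‖) ↦ hRR'.trans_le hx)
    (contDiffOn_id.congr fun x (hx : R < ‖x‖) ↦ hfix x hx.le)
  have hh0 : ∀ x, h x ≠ 0 := fun x hx ↦ by
    have := happ x
    simp [hx] at this
  refine no_contDiff_retraction_closedBall (f := fun x ↦ (R' / ‖h x‖) • h x) hR' ?_ ?_ ?_
  · exact (contDiff_const.div (hh.norm ℝ hh0) fun x ↦ norm_ne_zero_iff.2 (hh0 x)).smul hh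
  · intro x
    have := norm_ne_zero_iff.2 (hh0 x)
    rw [norm_smul, norm_div, norm_norm, Real.norm_of_nonneg hR'.le]
    field_simp
  · intro x hx
    have h1 : h x = x := by rw [heq hx.ge, hfix x (hx ▸ hRR'.le)]
    simp [h1, hx, hR'.ne']

end NoRetraction

section NonvanishingExtension

variable {E : Type*} [NormedAddCommGroup E] [NormedSpace ℝ E]

/-- `b` agrees on `K` with a nowhere vanishing continuous self-map of the whole space. -/
def HasNonvanishingExtension (K : Set E) (b : E → E) : Prop :=
  ∃ G : E → E, Continuous G ∧ (∀ x, G x ≠ 0) ∧ Set.EqOn G b K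

/-- Borsuk's homotopy extension theorem for nowhere vanishing maps. -/
theorem exists_nonvanishing_of_homotopy [FiniteDimensional ℝ E] {K : Set E} (hK : IsClosed K)
    {H : K × unitInterval → E} (hH : Continuous H) (hH0 : ∀ p, H p ≠ 0)
    {G : E → E} (hG : Continuous G) (hG0 : ∀ x, G x ≠ 0) (hHG : ∀ k : K, H (k, 0) = G k) :
    ∃ G' : E → E, Continuous G' ∧ (∀ x, G' x ≠ 0) ∧ ∀ k : K, G' k = H (k, 1) := by
  have he : Topology.IsClosedEmbedding
      (Prod.map Subtype.val id : K × unitInterval → E × unitInterval) :=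
    hK.isClosedEmbedding_subtypeVal.prodMap Topology.IsClosedEmbedding.id
  obtain ⟨T, hT⟩ := ContinuousMap.exists_extension' he
    (⟨fun p ↦ H p - G p.1, by fun_prop⟩ : C(K × unitInterval, E))
  have hT' : ∀ (k : K) (t : unitInterval), T (k, t) = H (k, t) - G k :=
    fun k t ↦ congrFun hT (k, t)
  let H' : E × unitInterval → E := fun p ↦ G p.1 + T p - T (p.1, 0)
  have hH' : Continuous H' := by fun_prop
  have hH'0 : ∀ x, H' (x, 0) = G x := fun x ↦ by simp [H']
  have hH'K : ∀ (k : K) t, H' (k, t) = H (k, t) := fun k t ↦ by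
    simp [H', hT', hHG]
  let Z : Set E := Prod.fst '' (H' ⁻¹' {0})
  have hZ : IsClosed Z := isClosedMap_fst_of_compactSpace _ (isClosed_singleton.preimage hH')
  have hZK : Disjoint Z K := by
    rw [Set.disjoint_left]
    rintro _ ⟨⟨x, t⟩, hx, rfl⟩ hk
    exact hH0 (⟨x, hk⟩, t) ((hH'K ⟨x, hk⟩ t).symm.trans hx)
  obtain ⟨l, hl0, hl1, hl⟩ := exists_continuous_zero_one_of_isClosed hZ hK hZK
  refine ⟨fun x ↦ H' (x, ⟨l x, hl x⟩), by fun_prop, fun x hx ↦ ?_, fun k ↦ ?_⟩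
  · have hxZ : x ∈ Z := ⟨_, hx, rfl⟩
    have : (⟨l x, hl x⟩ : unitInterval) = 0 := Subtype.ext (hl0 hxZ)
    simp only [this, hH'0] at hx
    exact hG0 x hx
  · have : (⟨l k, hl k⟩ : unitInterval) = 1 := Subtype.ext (hl1 k.2)
    simp only [this, hH'K]

/-- A parametrised form of `exists_nonvanishing_of_homotopy`. -/
theorem exists_nonvanishing_of_homotopy_comp [FiniteDimensional ℝ E] {P : Type*}
    [TopologicalSpace P] [CompactSpace P] {φ : P → E} (hφ : Continuous φ)
    {F : P × unitInterval → E} (hF : Continuous F) (hF0 : ∀ p, F p ≠ 0)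
    (hFφ : ∀ p p', φ p = φ p' → ∀ t, F (p, t) = F (p', t))
    {G : E → E} (hG : Continuous G) (hG0 : ∀ x, G x ≠ 0) (hFG : ∀ p, F (p, 0) = G (φ p)) :
    ∃ G' : E → E, Continuous G' ∧ (∀ x, G' x ≠ 0) ∧ ∀ p, G' (φ p) = F (p, 1) := by
  let π : C(P × unitInterval, Set.range φ × unitInterval) :=
    ⟨Prod.map (Set.rangeFactorization φ) id, by fun_prop⟩
  have hπs : Function.Surjective π :=
    Set.rangeFactorization_surjective.prodMap Function.surjective_id
  have hπ : Topology.IsQuotientMap π := π.continuous.isClosedMap.isQuotientMap π.continuous hπs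
  have hfac : ∀ p p', π p = π p' → F p = F p' := by
    rintro ⟨p, t⟩ ⟨p', t'⟩ h
    obtain ⟨h1, rfl⟩ := Prod.ext_iff.1 h
    exact hFφ p p' (congrArg Subtype.val h1) t
  let H : C(Set.range φ × unitInterval, E) := hπ.lift ⟨F, hF⟩ hfac
  have hHπ : ∀ p, H (π p) = F p := fun p ↦ by
    exact congrArg (fun f : C(P × unitInterval, E) ↦ f p) (hπ.lift_comp ⟨F, hF⟩ hfac)
  obtain ⟨G', h1, h2, h3⟩ := exists_nonvanishing_of_homotopy (isCompact_range hφ).isClosed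
    H.continuous (fun x ↦ by obtain ⟨p, rfl⟩ := hπs x; rw [hHπ]; exact hF0 p) hG hG0
    (by
      rintro ⟨_, p, rfl⟩
      exact (hHπ (p, 0)).trans (hFG p))
  exact ⟨G', h1, h2, fun p ↦ (h3 ⟨φ p, p, rfl⟩).trans (hHπ (p, 1))⟩

theorem hasNonvanishingExtension_sub_of_norm_lt [FiniteDimensional ℝ E] {K : Set E}
    (hK : IsClosed K) {R : ℝ} (hKR : ∀ x ∈ K, ‖x‖ ≤ R) {w : E} (hw : R < ‖w‖) (hw0 : w ≠ 0) :
    HasNonvanishingExtension K (fun x ↦ x - w) := by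
  obtain ⟨G, h1, h2, h3⟩ := exists_nonvanishing_of_homotopy hK
    (H := fun p ↦ (p.2 : ℝ) • (p.1 : E) - w) (by fun_prop)
    (fun p hp ↦ by
      rw [sub_eq_zero] at hp
      have h := hKR p.1 p.1.2
      have : ‖w‖ ≤ ‖(p.1 : E)‖ := by
        rw [← hp, norm_smul, Real.norm_of_nonneg p.2.2.1]
        exact mul_le_of_le_one_left (norm_nonneg _) p.2.2.2
      linarith)
    (G := fun _ ↦ -w) continuous_const (fun _ ↦ neg_ne_zero.2 hw0) (fun k ↦ by simp)
  exact ⟨G, h1, h2, fun k hk ↦ by simpa using h3 ⟨k, hk⟩⟩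

theorem HasNonvanishingExtension.sub_of_segment_disjoint [FiniteDimensional ℝ E] {K : Set E}
    (hK : IsClosed K) {w w' : E} (hd : Disjoint (segment ℝ w w') K)
    (h : HasNonvanishingExtension K (fun x ↦ x - w)) :
    HasNonvanishingExtension K (fun x ↦ x - w') := by
  obtain ⟨G, hG, hG0, hGK⟩ := h
  obtain ⟨G', h1, h2, h3⟩ := exists_nonvanishing_of_homotopy hK
    (H := fun p ↦ (p.1 : E) - AffineMap.lineMap w w' (p.2 : ℝ))
    (by
      have : Continuous (AffineMap.lineMap w w' : ℝ → E) := AffineMap.lineMap_continuous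
      fun_prop)
    (fun p hp ↦ by
      rw [sub_eq_zero] at hp
      refine Set.disjoint_left.1 hd ?_ p.1.2
      rw [hp, segment_eq_image_lineMap]
      exact ⟨_, p.2.2, rfl⟩)
    hG hG0 (fun k ↦ by simp [hGK k.2])
  exact ⟨G', h1, h2, fun k hk ↦ by simpa using h3 ⟨k, hk⟩⟩

/-- If a preconnected set avoiding `L` joins the point at infinity `N` of a chart to the point
with coordinate `w`, then `x ↦ x - w` on `L` has a nonvanishing extension. -/
theorem hasNonvanishingExtension_of_isPreconnected [FiniteDimensional ℝ E] {S : Type*}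
    [TopologicalSpace S] [T2Space S] {N : S} {σ : OpenPartialHomeomorph S E}
    (hs : σ.source = {N}ᶜ) (ht : σ.target = Set.univ) {L T : Set S} (hL : IsCompact L)
    (hT : IsPreconnected T) (hTL : Disjoint T L) (hN : N ∈ T) {w : E} (hw : σ.symm w ∈ T) :
    HasNonvanishingExtension (σ '' L) (fun x ↦ x - w) := by
  have hLs : L ⊆ σ.source := fun x hx ↦ by
    rw [hs]
    rintro rfl
    exact Set.disjoint_left.1 hTL hN hx
  have hK : IsCompact (σ '' L) := hL.image_of_continuousOn (σ.continuousOn.mono hLs)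
  have hemb : Topology.IsOpenEmbedding σ.symm := σ.symm.isOpenEmbedding (by simpa using ht)
  let Q : S → Prop := fun v ↦ ∀ w, σ.symm w = v → HasNonvanishingExtension (σ '' L) (fun x ↦ x - w)
  have hQN : Q N := fun w hw ↦ by
    have : σ.symm w ∈ σ.source := σ.map_target (by simp [ht])
    rw [hw, hs] at this
    exact absurd rfl this
  have key : Q N ↔ Q (σ.symm w) := by
    refine hT.induction₂' (fun v v' ↦ (Q v ↔ Q v')) (fun v hv ↦ ?_)
      (fun _ _ _ _ _ _ h h' ↦ h.trans h') hN hw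
    suffices ∀ᶠ v' in nhds v, (Q v ↔ Q v') from
      (this.filter_mono nhdsWithin_le_nhds).mono fun _ h ↦ ⟨h, h.symm⟩
    by_cases hvN : v = N
    · subst hvN
      obtain ⟨R, hR⟩ := hK.isBounded.exists_norm_le
      have hC : IsClosed (σ.symm '' Metric.closedBall 0 (max R 0)) :=
        ((isCompact_closedBall _ _).image hemb.continuous).isClosed
      filter_upwards [hC.isOpen_compl.mem_nhds (x := v) (by
        rintro ⟨w, -, hw⟩
        have : σ.symm w ∈ σ.source := σ.map_target (by simp [ht])
        rw [hw, hs] at this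
        exact absurd rfl this)] with v' hv'
      refine iff_of_true hQN fun w hw ↦ ?_
      have hw' : max R 0 < ‖w‖ := by
        by_contra! h
        exact hv' ⟨w, by simpa using h, hw⟩
      exact hasNonvanishingExtension_sub_of_norm_lt hK.isClosed hR
        ((le_max_left _ _).trans_lt hw') (norm_pos_iff.1 ((le_max_right _ _).trans_lt hw'))
    · have hvs : v ∈ σ.source := by rw [hs]; exact hvN
      have hvK : σ v ∉ σ '' L := by
        rintro ⟨x, hx, hxv⟩
        rw [σ.injOn (hLs hx) hvs hxv] at hx
        exact Set.disjoint_left.1 hTL hv hx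
      obtain ⟨ε, hε, hball⟩ := Metric.mem_nhds_iff.1 (hK.isClosed.isOpen_compl.mem_nhds hvK)
      filter_upwards [σ.continuousAt hvs (Metric.ball_mem_nhds _ hε), σ.open_source.mem_nhds hvs]
        with v' hv' hvs'
      have hinj : ∀ {a b}, a ∈ σ.source → σ.symm b = a → b = σ a := fun {a b} _ h ↦ by
        rw [← h, σ.right_inv (by simp [ht])]
      have hseg : segment ℝ (σ v) (σ v') ⊆ (σ '' L)ᶜ :=
        ((convex_ball _ _).segment_subset (Metric.mem_ball_self hε) hv').trans hball
      constructor
      · rintro h b hb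
        rw [hinj hvs' hb]
        exact (h _ (σ.left_inv hvs)).sub_of_segment_disjoint hK.isClosed
          (Set.disjoint_left.2 fun x hx ↦ hseg hx)
      · rintro h b hb
        rw [hinj hvs hb]
        exact (h _ (σ.left_inv hvs')).sub_of_segment_disjoint hK.isClosed
          (Set.disjoint_left.2 fun x hx ↦ hseg (by rwa [segment_symm]))
  exact key.1 hQN w rfl

end NonvanishingExtension

/-- An open connected set `U` disjoint from the image of `f`, with frontier contained in that
image, which is adherent to `f q` is adherent to `f y`, provided that a neighbourhood of `q` and
`y` can be pushed away from itself in the complement of `y`. -/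
theorem mem_closure_of_deformation {E : Type*} [NormedAddCommGroup E]
    [InnerProductSpace ℝ E] [FiniteDimensional ℝ E] {X S : Type*} [TopologicalSpace X]
    [CompactSpace X] [TopologicalSpace S] [CompactSpace S] [T2Space S] {f : X → S}
    (hf : Continuous f) {y q : X} {σ : OpenPartialHomeomorph S E} (hs : σ.source = {f y}ᶜ)
    (ht : σ.target = Set.univ) {M D : Set X} (hM : IsClosed M) (hMD : Mᶜ ⊆ D)
    (hD : ∀ p ∈ D, ∀ p', f p' = f p → p' = p) (hMc : IsPreconnected Mᶜ) (hyM : y ∉ M)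
    (hqM : q ∉ M) {h : X × unitInterval → X} (hh : ContinuousOn h {p | p.1 ≠ y})
    (hh0 : ∀ p, h (p, 0) = p) (hh1 : ∀ p, p ≠ y → h (p, 1) ∈ M)
    (hhy : ∀ p t, p ≠ y → h (p, t) ≠ y) (hhD : ∀ p t, p ∉ D → h (p, t) = p)
    {U : Set S} (hUo : IsOpen U) (hUc : IsPreconnected U) (hUf : Disjoint U (Set.range f))
    (hUfr : closure U \ U ⊆ Set.range f) (hq : f q ∈ closure U) : f y ∈ closure U := by
  classical
  by_contra hy
  have hsrc : ∀ {x}, x ≠ y → f x ∈ σ.source := fun {x} hx ↦ by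
    rw [hs]
    exact fun h ↦ hx (hD y (hMD hyM) x h)
  have hUs : closure U ⊆ σ.source := fun x hx ↦ by
    rw [hs]
    rintro rfl
    exact hy hx
  obtain ⟨u, hu⟩ : U.Nonempty := closure_nonempty_iff.1 ⟨_, hq⟩
  let w := σ u
  have hw : σ.symm w = u := σ.left_inv (hUs (subset_closure hu))
  have hemb : Topology.IsOpenEmbedding σ.symm := σ.symm.isOpenEmbedding (by simpa using ht)
  have hne_w : ∀ {x}, x ≠ y → σ (f x) - w ≠ 0 := fun {x} hx h0 ↦ by
    have := σ.injOn (hsrc hx) (hUs (subset_closure hu)) (sub_eq_zero.1 h0)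
    exact Set.disjoint_left.1 hUf hu ⟨x, this⟩
  have hT : IsPreconnected ((insert (f q) U) ∪ f '' Mᶜ) :=
    IsPreconnected.union (f q) (Set.mem_insert _ _) ⟨q, hqM, rfl⟩
      (hUc.subset_closure (Set.subset_insert _ _) (Set.insert_subset hq subset_closure))
      (hMc.image f hf.continuousOn)
  have hTM : Disjoint ((insert (f q) U) ∪ f '' Mᶜ) (f '' M) := by
    have h1 : ∀ p, p ∉ M → f p ∉ f '' M := by
      rintro p hp ⟨m, hm, hmp⟩
      exact hp (hD p (hMD hp) m hmp ▸ hm)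
    rw [Set.disjoint_left]
    rintro x ((rfl | hx) | ⟨p, hp, rfl⟩)
    · exact h1 q hqM
    · exact fun h ↦ Set.disjoint_left.1 hUf hx (Set.image_subset_range _ _ h)
    · exact h1 p hp
  obtain ⟨G, hG, hG0, hGM⟩ := hasNonvanishingExtension_of_isPreconnected hs ht
    (hM.isCompact.image hf) hT hTM (Or.inr ⟨y, hyM, rfl⟩) (w := w)
    (hw ▸ Or.inl (Set.mem_insert_of_mem _ hu))
  let P : Set X := f ⁻¹' closure U
  have hPy : ∀ p : P, (p : X) ≠ y := fun p hp ↦ hy (hp ▸ p.2)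
  have : CompactSpace P := isCompact_iff_compactSpace.1 (isClosed_closure.preimage hf).isCompact
  have hσf : ContinuousOn (fun x ↦ σ (f x)) {y}ᶜ :=
    σ.continuousOn.comp hf.continuousOn fun x hx ↦ hsrc hx
  let k : P × unitInterval → E := fun p ↦ σ (f (h (p.1, p.2)))
  have hk : Continuous k := by
    refine hσf.comp_continuous (hh.comp_continuous (by fun_prop) fun p ↦ hPy p.1) fun p ↦ ?_
    exact hhy _ _ (hPy p.1)
  have hk0 : ∀ p, k (p, 0) = σ (f p) := fun p ↦ by simp [k, hh0]
  have hkφ : ∀ p p' : P, σ (f p) = σ (f p') → ∀ t, k (p, t) = k (p', t) := by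
    intro p p' hpp t
    have hpp' := σ.injOn (hsrc (hPy p)) (hsrc (hPy p')) hpp
    by_cases hp : (p : X) ∈ D
    · rw [Subtype.ext (hD _ hp _ hpp'.symm)]
    by_cases hp' : (p' : X) ∈ D
    · rw [Subtype.ext (hD _ hp' _ hpp')]
    simp only [k, hhD _ t hp, hhD _ t hp', hpp']
  have hφ : Continuous fun p : P ↦ σ (f p) := by
    refine (hk.comp (Continuous.prodMk_left (0 : unitInterval))).congr fun p ↦ hk0 p
  obtain ⟨G₁, hG₁, hG₁0, hG₁P⟩ := exists_nonvanishing_of_homotopy_comp hφ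
    (F := fun p ↦ G (k p)) (hG.comp hk) (fun p ↦ hG0 _) (fun p p' hpp t ↦ by rw [hkφ p p' hpp])
    hG hG0 (fun p ↦ by rw [hk0])
  obtain ⟨G₂, hG₂, hG₂0, hG₂P⟩ := exists_nonvanishing_of_homotopy_comp hφ
    (F := fun p ↦ k (p.1, unitInterval.symm p.2) - w) (by fun_prop)
    (fun p ↦ hne_w (hhy _ _ (hPy p.1))) (fun p p' hpp t ↦ by simp only [hkφ p p' hpp])
    hG₁ hG₁0 (fun p ↦ by
      rw [hG₁P, unitInterval.symm_zero]
      exact (hGM ⟨_, ⟨_, hh1 p (hPy p), rfl⟩, rfl⟩).symm)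
  simp only [unitInterval.symm_one, hk0] at hG₂P
  let C : Set E := σ.symm ⁻¹' U
  have hCo : IsOpen C := hUo.preimage hemb.continuous
  have hCfr : ∀ x ∈ frontier C, G₂ x = x - w := by
    intro x hx
    rw [hCo.frontier_eq] at hx
    have h1 : σ.symm x ∈ closure U := closure_minimal (Set.preimage_mono subset_closure)
      (isClosed_closure.preimage hemb.continuous) hx.1
    obtain ⟨p, hp⟩ := hUfr ⟨h1, hx.2⟩
    have h2 := hG₂P ⟨p, show f p ∈ closure U from hp ▸ h1⟩
    simp only [hp, σ.right_inv (show x ∈ σ.target by simp [ht])] at h2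
    exact h2
  have hgc : Continuous fun x ↦ if x ∈ C then G₂ x else x - w :=
    continuous_if hCfr hG₂.continuousOn (by fun_prop)
  have hCb : Bornology.IsBounded C := by
    have h1 : IsCompact (σ '' closure U) :=
      isClosed_closure.isCompact.image_of_continuousOn (σ.continuousOn.mono hUs)
    refine h1.isBounded.subset fun x hx ↦ ⟨σ.symm x, subset_closure hx, ?_⟩
    exact σ.right_inv (by simp [ht])
  obtain ⟨R, hR⟩ := hCb.exists_norm_le
  obtain ⟨x, hx⟩ := exists_eq_zero_of_eq_self_of_norm_ge
    (g := fun x ↦ if x + w ∈ C then G₂ (x + w) else x + w - w)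
    (hgc.comp (continuous_id.add continuous_const)) (R := R + ‖w‖ + 1) (fun x hx ↦ by
      rw [if_neg, add_sub_cancel_right]
      intro hxC
      have h1 := hR _ hxC
      have h2 := norm_sub_le (x + w) w
      rw [add_sub_cancel_right] at h2
      linarith)
  split_ifs at hx with hxC
  · exact hG₂0 _ hx
  · refine hxC ?_
    rw [sub_eq_zero.1 hx]
    exact show σ.symm w ∈ U from hw ▸ hu

section SphericalCap

variable {F : Type*} [NormedAddCommGroup F]

/-- Radial projection to the unit sphere, with value `x₀` at the origin. -/
noncomputable def sphereProj [NormedSpace ℝ F] (x₀ : Metric.sphere (0 : F) 1) (v : F) :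
    Metric.sphere (0 : F) 1 :=
  open Classical in
  if hv : v = 0 then x₀ else ⟨‖v‖⁻¹ • v, by simp [norm_smul, hv]⟩

theorem coe_sphereProj [NormedSpace ℝ F] (x₀ : Metric.sphere (0 : F) 1) {v : F} (hv : v ≠ 0) :
    (sphereProj x₀ v : F) = ‖v‖⁻¹ • v := by
  simp [sphereProj, hv]

theorem sphereProj_coe [NormedSpace ℝ F] (x₀ p : Metric.sphere (0 : F) 1) :
    sphereProj x₀ (p : F) = p :=
  Subtype.ext (by simp [coe_sphereProj x₀ (ne_zero_of_mem_unit_sphere p)])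

theorem continuousOn_sphereProj [NormedSpace ℝ F] (x₀ : Metric.sphere (0 : F) 1) :
    ContinuousOn (sphereProj x₀) {0}ᶜ := by
  rw [Topology.IsEmbedding.subtypeVal.continuousOn_iff]
  refine ContinuousOn.congr (f := fun v : F ↦ ‖v‖⁻¹ • v) ?_ fun v hv ↦ coe_sphereProj x₀ hv
  exact (continuous_norm.continuousOn.inv₀ fun v hv ↦ norm_ne_zero_iff.2 hv).smul continuousOn_id

variable [InnerProductSpace ℝ F]

theorem inner_sphereProj_gt_iff (x₀ : Metric.sphere (0 : F) 1) {κ : ℝ} {v : F} (hv : v ≠ 0) :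
    κ < ⟪(sphereProj x₀ v : F), x₀⟫ ↔ κ * ‖v‖ < ⟪v, (x₀ : F)⟫ := by
  rw [coe_sphereProj x₀ hv, real_inner_smul_left, inv_mul_eq_div,
    lt_div_iff₀ (norm_pos_iff.2 hv)]

theorem isPreconnected_sphericalCap (x₀ : Metric.sphere (0 : F) 1) {κ : ℝ} (hκ : 0 < κ) :
    IsPreconnected {p : Metric.sphere (0 : F) 1 | κ < ⟪(p : F), x₀⟫} := by
  let V : Set F := {v | κ * ‖v‖ < ⟪v, (x₀ : F)⟫}
  have hV : Convex ℝ V := by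
    intro a ha b hb s t hs ht hst
    simp only [V, Set.mem_ofPred_eq, inner_add_left, real_inner_smul_left] at ha hb ⊢
    have h1 : ‖s • a + t • b‖ ≤ s * ‖a‖ + t * ‖b‖ :=
      (norm_add_le _ _).trans (by simp [norm_smul, abs_of_nonneg hs, abs_of_nonneg ht])
    have h2 := mul_le_mul_of_nonneg_left h1 hκ.le
    rcases hs.eq_or_lt with rfl | hs
    · obtain rfl : t = 1 := by linarith
      linarith
    · nlinarith [mul_lt_mul_of_pos_left ha hs, mul_le_mul_of_nonneg_left hb.le ht]
  have hV0 : ∀ v ∈ V, v ≠ 0 := by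
    rintro v hv rfl
    simp [V] at hv
  have himg : {p : Metric.sphere (0 : F) 1 | κ < ⟪(p : F), x₀⟫} = sphereProj x₀ '' V := by
    ext p
    constructor
    · intro hp
      exact ⟨p, by simpa [V] using hp, sphereProj_coe x₀ p⟩
    · rintro ⟨v, hv, rfl⟩
      exact (inner_sphereProj_gt_iff x₀ (hV0 v hv)).2 hv
  rw [himg]
  exact hV.isPreconnected.image _ ((continuousOn_sphereProj x₀).mono hV0)

theorem sub_smul_ne_zero_of_ne {p y : Metric.sphere (0 : F) 1} (hpy : p ≠ y) {c : ℝ}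
    (hc : 0 ≤ c) : (p : F) - c • (y : F) ≠ 0 := by
  intro h
  have h1 := sub_eq_zero.1 h
  have h2 := congrArg norm h1
  rw [norm_smul, norm_eq_of_mem_sphere, norm_eq_of_mem_sphere, mul_one,
    Real.norm_of_nonneg hc] at h2
  rw [← h2, one_smul] at h1
  exact hpy (Subtype.ext h1)

theorem sphereProj_sub_smul_ne (x₀ : Metric.sphere (0 : F) 1) {p y : Metric.sphere (0 : F) 1}
    (hpy : p ≠ y) {c : ℝ} (hc : 0 ≤ c) : sphereProj x₀ ((p : F) - c • (y : F)) ≠ y := by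
  intro h
  have h0 := sub_smul_ne_zero_of_ne hpy hc
  have h1 : ‖(p : F) - c • (y : F)‖⁻¹ • ((p : F) - c • (y : F)) = y := by
    rw [← coe_sphereProj x₀ h0, h]
  have h2 := (inv_smul_eq_iff₀ (norm_ne_zero_iff.2 h0)).1 h1
  refine sub_smul_ne_zero_of_ne hpy
    (c := ‖(p : F) - c • (y : F)‖ + c) (by positivity) ?_
  rw [add_smul, ← sub_sub, sub_right_comm, sub_eq_zero]
  exact h2

/-- Pushing away from a point `y` of a spherical cap, supported in a larger cap. -/
theorem exists_deformation_sphericalCap (x₀ y : Metric.sphere (0 : F) 1) {κ' κ : ℝ}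
    (hκ' : κ' < κ) (hκ : 0 < κ) (hy : κ < ⟪(y : F), x₀⟫) :
    ∃ h : Metric.sphere (0 : F) 1 × unitInterval → Metric.sphere (0 : F) 1,
      ContinuousOn h {p | p.1 ≠ y} ∧ (∀ p, h (p, 0) = p) ∧
      (∀ p, p ≠ y → ⟪(h (p, 1) : F), x₀⟫ ≤ κ) ∧ (∀ p t, p ≠ y → h (p, t) ≠ y) ∧
      ∀ (p : Metric.sphere (0 : F) 1) t, ⟪(p : F), x₀⟫ ≤ κ' → h (p, t) = p := by
  let c : Metric.sphere (0 : F) 1 → ℝ := fun p ↦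
    ((κ - κ') * κ)⁻¹ * max 0 (⟪(p : F), x₀⟫ - κ')
  have hκκ : 0 < (κ - κ') * κ := mul_pos (sub_pos.2 hκ') hκ
  have hc : ∀ p, 0 ≤ c p := fun p ↦ by positivity
  have hcc : Continuous c := by fun_prop
  refine ⟨fun p ↦ sphereProj x₀ ((p.1 : F) - ((p.2 : ℝ) * c p.1) • (y : F)), ?_, fun p ↦ ?_,
    fun p hp ↦ ?_, fun p t hp ↦ ?_, fun p t hp ↦ ?_⟩
  · refine (continuousOn_sphereProj x₀).comp (Continuous.continuousOn (by fun_prop)) ?_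
    exact fun p hp ↦ sub_smul_ne_zero_of_ne hp (mul_nonneg p.2.2.1 (hc _))
  · simp [sphereProj_coe]
  · have h0 := sub_smul_ne_zero_of_ne hp (hc p)
    by_contra! hlt
    simp only [Set.Icc.coe_one, one_mul] at hlt
    rw [inner_sphereProj_gt_iff x₀ h0, inner_sub_left, real_inner_smul_left] at hlt
    have hp1 : ‖(p : F)‖ = 1 := norm_eq_of_mem_sphere p
    have hy1 : ‖(y : F)‖ = 1 := norm_eq_of_mem_sphere y
    have hx1 : ‖(x₀ : F)‖ = 1 := norm_eq_of_mem_sphere x₀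
    by_cases hpκ : κ < ⟪(p : F), x₀⟫
    · have h1 : ⟪(p : F), (x₀ : F)⟫ ≤ 1 := by
        simpa [hp1, hx1] using real_inner_le_norm (p : F) (x₀ : F)
      have h2 : 1 ≤ c p * κ := by
        have h3 : κ - κ' ≤ max 0 (⟪(p : F), x₀⟫ - κ') :=
          (sub_le_sub_right hpκ.le _).trans (le_max_right _ _)
        simp only [c]
        rw [inv_mul_eq_div, div_mul_eq_mul_div, one_le_div hκκ]
        gcongr
      have h4 : c p * κ ≤ c p * ⟪(y : F), x₀⟫ := mul_le_mul_of_nonneg_left hy.le (hc p)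
      have h5 : 0 < κ * ‖(p : F) - c p • (y : F)‖ := mul_pos hκ (norm_pos_iff.2 h0)
      linarith
    · have h1 : 1 ≤ ‖(p : F) - c p • (y : F)‖ + c p := by
        have := norm_add_le ((p : F) - c p • (y : F)) (c p • (y : F))
        rwa [sub_add_cancel, hp1, norm_smul, hy1, mul_one, Real.norm_of_nonneg (hc p)] at this
      have h4 : c p * κ ≤ c p * ⟪(y : F), x₀⟫ := mul_le_mul_of_nonneg_left hy.le (hc p)
      nlinarith
  · exact sphereProj_sub_smul_ne x₀ hp (mul_nonneg t.2.1 (hc p))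
  · have : c p = 0 := by simp [c, hp]
    simp [this, sphereProj_coe]

theorem dist_lt_iff_inner_gt (p x₀ : Metric.sphere (0 : F) 1) {r : ℝ} (hr : 0 ≤ r) :
    dist p x₀ < r ↔ 1 - r ^ 2 / 2 < ⟪(p : F), x₀⟫ := by
  have h1 := norm_sub_sq_real (p : F) (x₀ : F)
  rw [norm_eq_of_mem_sphere, norm_eq_of_mem_sphere] at h1
  rw [Subtype.dist_eq, dist_eq_norm, ← sq_lt_sq₀ (norm_nonneg _) hr, h1]
  constructor <;> intro h <;> linarith

end SphericalCap

theorem IsConnCompIn.closure_diff_subset {S : Type*} [TopologicalSpace S]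
    [LocallyConnectedSpace S] {K U : Set S} (hK : IsClosed K) (hU : IsConnCompIn Kᶜ U) :
    closure U \ U ⊆ K := by
  obtain ⟨x, hx, rfl⟩ := hU
  rintro z ⟨hz, hzU⟩
  by_contra hzK
  obtain ⟨w, hw, hw'⟩ := mem_closure_iff.1 hz _ (hK.isOpen_compl.connectedComponentIn (x := z))
    (mem_connectedComponentIn hzK)
  refine hzU ?_
  rw [connectedComponentIn_eq hw', ← connectedComponentIn_eq hw]
  exact mem_connectedComponentIn hzK

/-- A complementary component of `f(Sⁿ)` adherent to one point of the image of an open ball in the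
set of injectivity is adherent to every point of that image. -/
theorem image_ball_subset_closure_of_isConnCompIn (n : ℕ)
    (f : (Metric.sphere (0 : EuclideanSpace ℝ (Fin (n + 1))) 1) →
         (Metric.sphere (0 : EuclideanSpace ℝ (Fin (n + 2))) 1))
    (hf : Continuous f)
    (x₀ : Metric.sphere (0 : EuclideanSpace ℝ (Fin (n + 1))) 1)
    (r : ℝ) (hr0 : 0 < r) (hr1 : r < 1)
    (hinj : ∀ p, dist p x₀ ≤ r → ∀ q, f q = f p → q = p)
    (U : Set (Metric.sphere (0 : EuclideanSpace ℝ (Fin (n + 2))) 1))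
    (hU : IsConnCompIn (Set.range f)ᶜ U)
    (hUcl : (closure U ∩ f '' {x | dist x x₀ < r}).Nonempty) :
    f '' {x | dist x x₀ < r} ⊆ closure U := by
  rintro _ ⟨y, hy, rfl⟩
  obtain ⟨_, hq', q, hq, rfl⟩ := hUcl
  have : Fact (Module.finrank ℝ (EuclideanSpace ℝ (Fin (n + 2))) = n + 1 + 1) := ⟨by simp⟩
  have : LocallyConnectedSpace (Metric.sphere (0 : EuclideanSpace ℝ (Fin (n + 2))) 1) :=
    ChartedSpace.locallyConnectedSpace (EuclideanSpace ℝ (Fin (n + 1))) _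
  have hy' := (dist_lt_iff_inner_gt y x₀ hr0.le).1 hy
  have hq'' := (dist_lt_iff_inner_gt q x₀ hr0.le).1 hq
  obtain ⟨κ, hκ', hκ⟩ := exists_between (lt_min hy' hq'')
  have hκ0 : 0 < κ := by nlinarith
  obtain ⟨hκy, hκq⟩ := lt_min_iff.1 hκ
  obtain ⟨h, hh, hh0, hh1, hhy, hhD⟩ := exists_deformation_sphericalCap x₀ y hκ' hκ0 hκy
  have hcl : IsClosed (Set.range f) := (isCompact_range hf).isClosed
  let M : Set (Metric.sphere (0 : EuclideanSpace ℝ (Fin (n + 1))) 1) :=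
    {p | ⟪(p : EuclideanSpace ℝ (Fin (n + 1))), x₀⟫ ≤ κ}
  have hMeq : Mᶜ = {p : Metric.sphere (0 : EuclideanSpace ℝ (Fin (n + 1))) 1 |
      κ < ⟪(p : EuclideanSpace ℝ (Fin (n + 1))), x₀⟫} := by
    ext p; simp [M]
  have hfr := hU.closure_diff_subset hcl
  obtain ⟨x, hx, rfl⟩ := hU
  refine mem_closure_of_deformation hf (y := y) (q := q) (σ := stereographic' (n + 1) (f y))
    (stereographic'_source _) (stereographic'_target _) (M := M)
    (D := {p | dist p x₀ < r}) (isClosed_le (by fun_prop) continuous_const) ?_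
    (fun p hp ↦ hinj p (le_of_lt hp)) ?_ (not_le.2 hκy) (not_le.2 hκq) hh hh0 hh1 hhy
    ?_ hcl.isOpen_compl.connectedComponentIn isPreconnected_connectedComponentIn ?_ hfr hq'
  · rw [hMeq]
    exact fun p hp ↦ (dist_lt_iff_inner_gt p x₀ hr0.le).2 (hκ'.trans hp)
  · rw [hMeq]
    exact isPreconnected_sphericalCap x₀ hκ0
  · intro p t hp
    exact hhD p t (not_lt.1 fun h' ↦ hp ((dist_lt_iff_inner_gt p x₀ hr0.le).2 h'))
  · exact Set.disjoint_left.2 fun z hz ↦ connectedComponentIn_subset _ _ hz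

end Auxiliary

/-- Let `n ≥ 1` and let `f : Sⁿ → Sⁿ⁺¹` be a continuous map whose set of
injectivity contains the closed metric ball `D` of radius `0 < r < 1` about `x₀ ∈ Sⁿ`, and
let `U₁, U₂` be the two connected components of `Sⁿ⁺¹ \ f(Sⁿ)` whose closures intersect
`f(D°)`.  Then every point of `f(D°)` lies in the closure of `U₁` and in the closure of
`U₂`. -/
theorem image_of_disk_interior_subset_closures_of_both_components
    (n : ℕ) (hn : 1 ≤ n)
    (f : (Metric.sphere (0 : EuclideanSpace ℝ (Fin (n + 1))) 1) →
         (Metric.sphere (0 : EuclideanSpace ℝ (Fin (n + 2))) 1))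
    (hf : Continuous f)
    (x₀ : Metric.sphere (0 : EuclideanSpace ℝ (Fin (n + 1))) 1)
    (r : ℝ) (hr0 : 0 < r) (hr1 : r < 1)
    (hinj : ∀ p, dist p x₀ ≤ r → ∀ q, f q = f p → q = p)
    (U₁ U₂ : Set (Metric.sphere (0 : EuclideanSpace ℝ (Fin (n + 2))) 1))
    (hU₁ : IsConnCompIn (Set.range f)ᶜ U₁)
    (hU₂ : IsConnCompIn (Set.range f)ᶜ U₂)
    (hU₁cl : (closure U₁ ∩ f '' {x | dist x x₀ < r}).Nonempty)
    (hU₂cl : (closure U₂ ∩ f '' {x | dist x x₀ < r}).Nonempty)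
    (hne : U₁ ≠ U₂) :
    f '' {x | dist x x₀ < r} ⊆ closure U₁ ∧ f '' {x | dist x x₀ < r} ⊆ closure U₂ := by
  exact ⟨image_ball_subset_closure_of_isConnCompIn n f hf x₀ r hr0 hr1 hinj U₁ hU₁ hU₁cl,
    image_ball_subset_closure_of_isConnCompIn n f hf x₀ r hr0 hr1 hinj U₂ hU₂ hU₂cl⟩
end

section
/- Let n ≥ 1 and let f : S^n → S^{n+1} be a continuous map whose set of injectivity I contains the closed metric ball D := {x ∈ S^n : |x − x₀| ≤ r} for some x₀ ∈ S^n and 0 < r < 1. Then for every p ∈ D° and every ε > 0, there are precisely two connected components of B(f(p), ε) \ f(S^n) which contain f(p) in their closure, where B(f(p), ε) denotes the open metric ball in S^{n+1} of radius ε centered at f(p). -/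
section Auxiliary

open MeasureTheory Set Filter Topology Metric
open scoped RealInnerProductSpace

section NullLagrangian

variable {E : Type*} [NormedAddCommGroup E] [NormedSpace ℝ E] [FiniteDimensional ℝ E]

/-- The determinant of an endomorphism is a fixed linear combination of the determinants of its
translates by scalars; the weights are given by Lagrange interpolation at `0`. -/
theorem det_eq_sum_det_smul_one_add (s : ℕ → ℝ) (hs : Function.Injective s) (A : E →L[ℝ] E) :
    A.det = ∑ j ∈ Finset.range (Module.finrank ℝ E + 1),
      (Lagrange.basis (Finset.range (Module.finrank ℝ E + 1)) s j).eval 0 *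
        (s j • (1 : E →L[ℝ] E) + A).det := by
  classical
  have key : ∀ t : ℝ, (LinearMap.charpoly (-(A : E →ₗ[ℝ] E))).eval t
      = (t • (1 : E →L[ℝ] E) + A).det := by
    intro t
    rw [LinearMap.eval_charpoly]
    congr 1
    ext x
    simp [Algebra.algebraMap_eq_smul_one]
  have h1 := Lagrange.eq_interpolate (F := ℝ) (s := Finset.range (Module.finrank ℝ E + 1)) (v := s)
    (f := LinearMap.charpoly (-(A : E →ₗ[ℝ] E))) hs.injOn (by
      rw [Polynomial.degree_eq_natDegree (LinearMap.charpoly_monic _).ne_zero,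
        LinearMap.charpoly_natDegree, Finset.card_range]
      exact_mod_cast Nat.lt_succ_self _)
  have h2 := congrArg (Polynomial.eval 0) h1
  rw [key, Lagrange.interpolate_apply, Polynomial.eval_finsetSum] at h2
  simp only [zero_smul, zero_add] at h2
  rw [h2]
  refine Finset.sum_congr rfl fun j _ => ?_
  simp only [key, Polynomial.eval_mul, Polynomial.eval_C]
  ring

theorem sum_basis_eval_zero_mul_pow (s : ℕ → ℝ) (hs : Function.Injective s) (k : ℕ) (hk : k ≠ 0) :
    ∑ j ∈ Finset.range (k + 1),
      (Lagrange.basis (Finset.range (k + 1)) s j).eval 0 * s j ^ k = 0 := by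
  have h1 := Lagrange.eq_interpolate (F := ℝ) (s := Finset.range (k + 1)) (v := s)
    (f := (Polynomial.X : Polynomial ℝ) ^ k) hs.injOn (by
      rw [Polynomial.degree_X_pow, Finset.card_range]
      exact_mod_cast Nat.lt_succ_self _)
  have h2 := congrArg (Polynomial.eval 0) h1
  rw [Lagrange.interpolate_apply, Polynomial.eval_finsetSum] at h2
  simp only [Polynomial.eval_pow, Polynomial.eval_X, Polynomial.eval_mul, Polynomial.eval_C] at h2
  rw [zero_pow hk] at h2
  refine Eq.trans ?_ h2.symm
  exact Finset.sum_congr rfl fun j _ => by ring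

variable [MeasurableSpace E] [BorelSpace E] (μ : Measure E) [μ.IsAddHaarMeasure]

theorem setIntegral_det_one_add_eq {w : E → E} (hw : ContDiff ℝ 1 w) {R : ℝ}
    (hR : ∀ x, w x ≠ 0 → x ∈ closedBall (0 : E) R) :
    ∃ t₀ > (0 : ℝ), ∀ t : ℝ, 0 ≤ t → t ≤ t₀ →
      ∫ x in closedBall (0 : E) R, ((1 : E →L[ℝ] E) + t • fderiv ℝ w x).det ∂μ
        = μ.real (closedBall (0 : E) R) := by
  have hsupp : HasCompactSupport w :=
    HasCompactSupport.intro (isCompact_closedBall (0 : E) R) fun x hx => by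
      by_contra h; exact hx (hR x h)
  obtain ⟨C, hC⟩ := ContDiff.lipschitzWith_of_hasCompactSupport hsupp hw one_ne_zero
  have hder : ∀ x, ‖fderiv ℝ w x‖ ≤ C := fun x => norm_fderiv_le_of_lipschitz ℝ hC
  have hdetpos : ∀ᶠ A : E →L[ℝ] E in 𝓝 1, 0 < A.det := by
    refine (ContinuousLinearMap.continuous_det.tendsto 1).eventually (lt_mem_nhds ?_)
    simp [ContinuousLinearMap.det]
  obtain ⟨η, hη, hball⟩ := Metric.eventually_nhds_iff.1 hdetpos
  refine ⟨min (η / (2 * (C + 1))) (1 / (2 * (C + 1))), by positivity, fun t ht0 ht => ?_⟩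
  have ht1 : t * (2 * (C + 1)) ≤ η := by
    have := ht.trans (min_le_left _ _)
    rwa [le_div_iff₀ (by positivity)] at this
  have ht2 : t * (2 * (C + 1)) ≤ 1 := by
    have := ht.trans (min_le_right _ _)
    rwa [le_div_iff₀ (by positivity)] at this
  have hC0 : (0 : ℝ) ≤ C := C.2
  set φ : E → E := fun x => x + t • w x with hφ
  have hder' : ∀ x, HasFDerivAt φ ((1 : E →L[ℝ] E) + t • fderiv ℝ w x) x := fun x =>
    (hasFDerivAt_id x).add (((hw.differentiable one_ne_zero) x).hasFDerivAt.const_smul t)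
  have hdist : ∀ x y, ‖t • w x - t • w y‖ ≤ 1 / 2 * ‖x - y‖ := by
    intro x y
    rw [← smul_sub, norm_smul, Real.norm_of_nonneg ht0]
    have := hC.norm_sub_le x y
    nlinarith [norm_nonneg (x - y), mul_le_mul_of_nonneg_left this ht0]
  have happ : ApproximatesLinearOn φ ((ContinuousLinearEquiv.refl ℝ E : E ≃L[ℝ] E) : E →L[ℝ] E)
      univ (1 / 2 : NNReal) := by
    intro x _ y _
    have : φ x - φ y - ((ContinuousLinearEquiv.refl ℝ E : E ≃L[ℝ] E) : E →L[ℝ] E) (x - y)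
        = t • w x - t • w y := by
      simp [hφ]; abel
    rw [this]
    simpa using hdist x y
  have hsub : Subsingleton E ∨ (1 / 2 : NNReal) <
      ‖(((ContinuousLinearEquiv.refl ℝ E : E ≃L[ℝ] E).symm : E ≃L[ℝ] E) : E →L[ℝ] E)‖₊⁻¹ := by
    rcases subsingleton_or_nontrivial E with h | h
    · exact Or.inl h
    · right
      have : ‖(((ContinuousLinearEquiv.refl ℝ E : E ≃L[ℝ] E).symm : E ≃L[ℝ] E) : E →L[ℝ] E)‖₊
          = 1 := by
        have := ContinuousLinearMap.nnnorm_id (𝕜 := ℝ) (E := E)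
        exact this
      rw [this]
      norm_num
  have hinj : Function.Injective φ := injOn_univ.1 (injOn_iff_injective.2 (happ.injective hsub))
  have hsurj : Function.Surjective φ := happ.surjective hsub
  have himage : φ '' closedBall (0 : E) R = closedBall (0 : E) R := by
    have hout : ∀ x, x ∉ closedBall (0 : E) R → φ x = x := by
      intro x hx
      have : w x = 0 := by by_contra h; exact hx (hR x h)
      simp [hφ, this]
    apply Subset.antisymm
    · rintro _ ⟨x, hx, rfl⟩
      by_contra h
      have := hinj (hout _ h)
      rw [this] at h
      exact h hx
    · intro y hy
      obtain ⟨x, rfl⟩ := hsurj y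
      by_cases hx : x ∈ closedBall (0 : E) R
      · exact ⟨x, hx, rfl⟩
      · rw [hout x hx] at hy
        exact absurd hy hx
  have hpos : ∀ x, 0 < ((1 : E →L[ℝ] E) + t • fderiv ℝ w x).det := by
    intro x
    apply hball
    rw [dist_eq_norm, add_sub_cancel_left, norm_smul, Real.norm_of_nonneg ht0]
    nlinarith [hder x, norm_nonneg (fderiv ℝ w x), mul_le_mul_of_nonneg_left (hder x) ht0]
  have hcv := integral_image_eq_integral_abs_det_fderiv_smul μ
    (isClosed_closedBall (x := (0 : E)) (ε := R)).measurableSet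
    (fun x _ => (hder' x).hasFDerivWithinAt) hinj.injOn (fun _ => (1 : ℝ))
  rw [himage] at hcv
  simp only [smul_eq_mul, mul_one, integral_const, MeasurableSet.univ, measureReal_restrict_apply,
    univ_inter] at hcv
  rw [hcv]
  exact integral_congr_ae (Eventually.of_forall fun x => (abs_of_pos (hpos x)).symm)

/-- The integral of the Jacobian determinant of a compactly supported map vanishes. -/
theorem integral_det_fderiv_eq_zero [Nontrivial E] {w : E → E} (hw : ContDiff ℝ 1 w)
    (hc : HasCompactSupport w) : ∫ x, (fderiv ℝ w x).det ∂μ = 0 := by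
  obtain ⟨R, hR⟩ := hc.isCompact.isBounded.subset_closedBall (0 : E)
  have hsupp : ∀ x, w x ≠ 0 → x ∈ closedBall (0 : E) R := fun x hx =>
    hR (subset_tsupport _ hx)
  obtain ⟨t₀, ht₀, ht⟩ := setIntegral_det_one_add_eq μ hw hsupp
  set s : ℕ → ℝ := fun j => t₀⁻¹ + j with hsdef
  have hs : Function.Injective s := fun i j h => by simpa [hsdef] using h
  have hcont : Continuous fun x => fderiv ℝ w x := hw.continuous_fderiv one_ne_zero
  have hk : Module.finrank ℝ E ≠ 0 := Module.finrank_pos.ne'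
  have hset : ∫ x in closedBall (0 : E) R, (fderiv ℝ w x).det ∂μ = ∫ x, (fderiv ℝ w x).det ∂μ := by
    refine setIntegral_eq_integral_of_forall_compl_eq_zero fun x hx => ?_
    have : fderiv ℝ w x = 0 := by
      by_contra h
      exact hx (hR (support_fderiv_subset ℝ h))
    rw [this, ContinuousLinearMap.det]
    simp
  have hval : ∀ j, ∫ x in closedBall (0 : E) R, (s j • (1 : E →L[ℝ] E) + fderiv ℝ w x).det ∂μ
      = s j ^ Module.finrank ℝ E * μ.real (closedBall (0 : E) R) := by
    intro j
    have hsj : 0 < s j := by positivity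
    rw [← ht (s j)⁻¹ (by positivity) (inv_le_of_inv_le₀ ht₀ (by simp [hsdef])),
      ← integral_const_mul]
    congr 1
    ext x
    have : s j • (1 : E →L[ℝ] E) + fderiv ℝ w x
        = s j • ((1 : E →L[ℝ] E) + (s j)⁻¹ • fderiv ℝ w x) := by
      rw [smul_add, smul_smul, mul_inv_cancel₀ hsj.ne', one_smul]
    rw [this, ContinuousLinearMap.det, ContinuousLinearMap.det]
    exact LinearMap.det_smul _ _
  rw [← hset]
  simp_rw [fun x => det_eq_sum_det_smul_one_add s hs (fderiv ℝ w x)]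
  rw [integral_finsetSum]
  · simp_rw [integral_const_mul, hval, ← mul_assoc, ← Finset.sum_mul,
      sum_basis_eval_zero_mul_pow s hs _ hk, zero_mul]
  · intro j _
    exact (continuous_const.mul (ContinuousLinearMap.continuous_det.comp
      (by fun_prop))).continuousOn.integrableOn_compact (isCompact_closedBall _ _)

end NullLagrangian

section DegreeIntegral

variable {E : Type*} [NormedAddCommGroup E] [NormedSpace ℝ E] [FiniteDimensional ℝ E]
  [Nontrivial E]

theorem ContinuousLinearMap.det_zero_of_nontrivial : (0 : E →L[ℝ] E).det = 0 := by
  rw [ContinuousLinearMap.det]; simp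

omit [FiniteDimensional ℝ E] [Nontrivial E] in
theorem ContDiff.continuous_det_fderiv {u : E → E} (hu : ContDiff ℝ 1 u) :
    Continuous fun x => (fderiv ℝ u x).det :=
  ContinuousLinearMap.continuous_det.comp (hu.continuous_fderiv one_ne_zero)

omit [Nontrivial E] in
theorem exists_contDiff_one_near_of_isCompact {K U : Set E} (hK : IsCompact K) (hU : IsOpen U)
    (hKU : K ⊆ U) : ∃ χ : E → ℝ, ContDiff ℝ 1 χ ∧ HasCompactSupport χ ∧ tsupport χ ⊆ U ∧
      (∀ x, χ x ∈ Icc (0 : ℝ) 1) ∧ ∀ x ∈ K, χ =ᶠ[𝓝 x] 1 := by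
  obtain ⟨V, hVo, hKV, hVU, hVc⟩ := exists_open_between_and_isCompact_closure hK hU hKU
  obtain ⟨W, hWo, hKW, hWV, hWc⟩ := exists_open_between_and_isCompact_closure hK hVo hKV
  obtain ⟨χ, h0, h1, h2⟩ := exists_contMDiffMap_zero_one_of_isClosed (n := 1)
    (modelWithCornersSelf ℝ E) (s := Vᶜ) (t := closure W) hVo.isClosed_compl isClosed_closure
    (by rw [disjoint_compl_left_iff_subset]; exact hWV)
  have hsub : Function.support χ ⊆ V := fun x hx => by
    by_contra h
    exact hx (h0 h)
  have hts : tsupport χ ⊆ closure V := closure_mono hsub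
  refine ⟨χ, χ.contMDiff.contDiff, hVc.of_isClosed_subset (isClosed_tsupport _) hts,
    hts.trans hVU, h2, fun x hx => ?_⟩
  filter_upwards [hWo.mem_nhds (hKW hx)] with y hy
  exact h1 (subset_closure hy)

variable [MeasurableSpace E] [BorelSpace E] (μ : Measure E) [μ.IsAddHaarMeasure]

omit [Nontrivial E] in
theorem Bornology.IsBounded.integrableOn_of_continuous {Ω : Set E} (hΩ : Bornology.IsBounded Ω)
    {f : E → ℝ} (hf : Continuous f) : IntegrableOn f Ω μ :=
  (hf.continuousOn.integrableOn_compact hΩ.isCompact_closure).mono_set subset_closure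

/-- The integral of the Jacobian determinant depends only on the values near the boundary. -/
theorem setIntegral_det_fderiv_congr {u v : E → E} (hu : ContDiff ℝ 1 u) (hv : ContDiff ℝ 1 v)
    {Ω : Set E} (hΩ : Bornology.IsBounded Ω) (hsub : tsupport (u - v) ⊆ Ω) :
    ∫ x in Ω, (fderiv ℝ u x).det ∂μ = ∫ x in Ω, (fderiv ℝ v x).det ∂μ := by
  have hK : IsCompact (tsupport (u - v)) :=
    hΩ.isCompact_closure.of_isClosed_subset (isClosed_tsupport _) (hsub.trans subset_closure)
  obtain ⟨χ, hχ, hχc, -, -, hχ1⟩ :=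
    exists_contDiff_one_near_of_isCompact hK isOpen_univ (subset_univ _)
  have h_int : ∀ w : E → E, ContDiff ℝ 1 w → Integrable (fun x => (fderiv ℝ (χ • w) x).det) μ ∧
      ∫ x, (fderiv ℝ (χ • w) x).det ∂μ = 0 := by
    intro w hw
    have hcd : ContDiff ℝ 1 (χ • w) := hχ.smul hw
    have hcs : HasCompactSupport (χ • w) := hχc.smul_right
    refine ⟨hcd.continuous_det_fderiv.integrable_of_hasCompactSupport ?_,
      integral_det_fderiv_eq_zero μ hcd hcs⟩
    exact (hcs.fderiv ℝ).comp_left (g := fun A : E →L[ℝ] E => A.det)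
      ContinuousLinearMap.det_zero_of_nontrivial
  have hpt : ∀ x, (fderiv ℝ u x).det - (fderiv ℝ v x).det
      = (fderiv ℝ (χ • u) x).det - (fderiv ℝ (χ • v) x).det := by
    intro x
    by_cases hx : x ∈ tsupport (u - v)
    · have h : ∀ w : E → E, χ • w =ᶠ[𝓝 x] w := fun w => by
        filter_upwards [hχ1 x hx] with y hy
        simp [hy]
      rw [(h u).fderiv_eq, (h v).fderiv_eq]
    · have h : u =ᶠ[𝓝 x] v := by
        filter_upwards [(isClosed_tsupport (u - v)).isOpen_compl.mem_nhds hx] with y hy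
        exact sub_eq_zero.1 (image_eq_zero_of_notMem_tsupport (f := u - v) hy)
      have h' : χ • u =ᶠ[𝓝 x] χ • v := by
        filter_upwards [h] with y hy
        simp [hy]
      rw [h.fderiv_eq, h'.fderiv_eq, sub_self, sub_self]
  rw [← sub_eq_zero, ← integral_sub (hΩ.integrableOn_of_continuous μ hu.continuous_det_fderiv)
    (hΩ.integrableOn_of_continuous μ hv.continuous_det_fderiv),
    setIntegral_eq_integral_of_forall_compl_eq_zero]
  · simp_rw [hpt]
    rw [integral_sub (h_int u hu).1 (h_int v hv).1, (h_int u hu).2, (h_int v hv).2, sub_zero]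
  · intro x hx
    have h : u =ᶠ[𝓝 x] v := by
      filter_upwards [(isClosed_tsupport (u - v)).isOpen_compl.mem_nhds fun h => hx (hsub h)]
        with y hy
      exact sub_eq_zero.1 (image_eq_zero_of_notMem_tsupport (f := u - v) hy)
    rw [h.fderiv_eq, sub_self]

variable (E) in
omit [MeasurableSpace E] [BorelSpace E] in
theorem exists_contDiff_det_fderiv_concentrated :
    ∃ P : E → E, ContDiff ℝ 1 P ∧ (∀ x, 1 ≤ ‖x‖ → (fderiv ℝ P x).det = 0) ∧
      (∀ x, 0 ≤ (fderiv ℝ P x).det) ∧ 0 < (fderiv ℝ P 0).det := by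
  set k := Module.finrank ℝ E with hk
  have : Nonempty (Fin k) := ⟨⟨0, Module.finrank_pos⟩⟩
  let e : E ≃L[ℝ] (Fin k → ℝ) := ContinuousLinearEquiv.ofFinrankEq (by simp [hk])
  set M : ℝ := ‖(e.symm : (Fin k → ℝ) →L[ℝ] E)‖ + 1
  have hM : 0 < M := by positivity
  set β : ℝ → ℝ := fun t => max 0 (M⁻¹ - |t|) with hβ
  have hβc : Continuous β := by fun_prop
  set σ : ℝ → ℝ := fun t => ∫ s in (0 : ℝ)..t, β s with hσ
  have hσd : ∀ t, HasDerivAt σ (β t) t := fun t =>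
    intervalIntegral.integral_hasDerivAt_right (hβc.intervalIntegrable _ _)
      hβc.aestronglyMeasurable.stronglyMeasurableAtFilter hβc.continuousAt
  have hσC : ContDiff ℝ 1 σ := by
    rw [contDiff_one_iff_deriv]
    refine ⟨fun t => (hσd t).differentiableAt, ?_⟩
    rw [show deriv σ = β from funext fun t => (hσd t).deriv]
    exact hβc
  set S : (Fin k → ℝ) → (Fin k → ℝ) := fun z i => σ (z i) with hS
  have hSC : ContDiff ℝ 1 S := contDiff_pi.2 fun i => hσC.comp (contDiff_apply ℝ ℝ i)
  have hSd : ∀ z, (fderiv ℝ S z).det = ∏ i, β (z i) := by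
    intro z
    have h1 : HasFDerivAt S (ContinuousLinearMap.pi fun i =>
        β (z i) • (ContinuousLinearMap.proj i : (Fin k → ℝ) →L[ℝ] ℝ)) z := by
      rw [hasFDerivAt_pi]
      intro i
      have h2 : HasFDerivAt (fun z : Fin k → ℝ => z i)
        (ContinuousLinearMap.proj i : (Fin k → ℝ) →L[ℝ] ℝ) z := hasFDerivAt_apply i z
      exact (hσd (z i)).comp_hasFDerivAt z h2
    rw [h1.fderiv, ContinuousLinearMap.det, ← Matrix.det_diagonal, ← LinearMap.det_toLin']
    congr 1
    ext j i
    simp [Matrix.toLin'_apply, Matrix.mulVec_diagonal]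
  have hPd : ∀ x, (fderiv ℝ (fun x => e.symm (S (e x))) x).det = ∏ i, β (e x i) := by
    intro x
    have h1 : HasFDerivAt (fun x => e.symm (S (e x)))
        ((e.symm : (Fin k → ℝ) →L[ℝ] E) ∘L (fderiv ℝ S (e x)) ∘L (e : E →L[ℝ] (Fin k → ℝ))) x :=
      e.symm.hasFDerivAt.comp x
        (((hSC.differentiable one_ne_zero) (e x)).hasFDerivAt.comp x e.hasFDerivAt)
    rw [h1.fderiv, ← hSd, ContinuousLinearMap.det, ContinuousLinearMap.det]
    exact LinearMap.det_conj (fderiv ℝ S (e x) : (Fin k → ℝ) →ₗ[ℝ] (Fin k → ℝ))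
      e.symm.toLinearEquiv
  refine ⟨fun x => e.symm (S (e x)), e.symm.contDiff.comp (hSC.comp e.contDiff), ?_, ?_, ?_⟩
  · intro x hx
    rw [hPd]
    have h1 : M⁻¹ ≤ ‖e x‖ := by
      rw [inv_le_iff_one_le_mul₀ hM]
      have : ‖x‖ ≤ ‖(e.symm : (Fin k → ℝ) →L[ℝ] E)‖ * ‖e x‖ := by
        simpa using (e.symm : (Fin k → ℝ) →L[ℝ] E).le_opNorm (e x)
      nlinarith [norm_nonneg (e x)]
    obtain ⟨i, hi⟩ : ∃ i, M⁻¹ ≤ ‖e x i‖ := by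
      by_contra! h
      exact absurd ((pi_norm_lt_iff (inv_pos.2 hM)).2 h) (not_lt.2 h1)
    refine Finset.prod_eq_zero (Finset.mem_univ i) ?_
    rw [Real.norm_eq_abs] at hi
    simp [hβ, hi]
  · intro x
    rw [hPd]
    exact Finset.prod_nonneg fun i _ => le_max_left _ _
  · rw [hPd]
    refine Finset.prod_pos fun i _ => ?_
    simp [hβ, hM]

variable (E) in
/-- A `C¹` map whose Jacobian determinant is nonnegative and concentrated in the unit ball. -/
noncomputable def concentratedMap : E → E :=
  Classical.choose (exists_contDiff_det_fderiv_concentrated E)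

omit [MeasurableSpace E] [BorelSpace E] in
theorem contDiff_concentratedMap : ContDiff ℝ 1 (concentratedMap E) :=
  (Classical.choose_spec (exists_contDiff_det_fderiv_concentrated E)).1

variable (E) in
/-- The Jacobian determinant of `concentratedMap`. -/
noncomputable def concentratedDensity (x : E) : ℝ := (fderiv ℝ (concentratedMap E) x).det

omit [MeasurableSpace E] [BorelSpace E] in
theorem continuous_concentratedDensity : Continuous (concentratedDensity E) :=
  contDiff_concentratedMap.continuous_det_fderiv

omit [MeasurableSpace E] [BorelSpace E] in
theorem concentratedDensity_eq_zero {x : E} (hx : 1 ≤ ‖x‖) : concentratedDensity E x = 0 :=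
  (Classical.choose_spec (exists_contDiff_det_fderiv_concentrated E)).2.1 x hx

theorem integral_concentratedDensity_pos : 0 < ∫ x, concentratedDensity E x ∂μ := by
  refine continuous_concentratedDensity.integral_pos_of_hasCompactSupport_nonneg_nonzero ?_
    (Classical.choose_spec (exists_contDiff_det_fderiv_concentrated E)).2.2.1
    (Classical.choose_spec (exists_contDiff_det_fderiv_concentrated E)).2.2.2.ne'
  refine HasCompactSupport.intro (isCompact_closedBall (0 : E) 1) fun x hx => ?_
  refine concentratedDensity_eq_zero ?_
  simp at hx
  exact hx.le

/-- The analytic degree of a `C¹` map `F` on `Ω` with respect to the unit ball. -/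
noncomputable def degreeIntegral (F : E → E) (Ω : Set E) : ℝ :=
  (∫ x, concentratedDensity E x ∂μ)⁻¹ *
    ∫ x in Ω, concentratedDensity E (F x) * (fderiv ℝ F x).det ∂μ

omit [MeasurableSpace E] [BorelSpace E] in
theorem det_fderiv_concentratedMap_comp {F : E → E} (hF : ContDiff ℝ 1 F) (x : E) :
    (fderiv ℝ (concentratedMap E ∘ F) x).det
      = concentratedDensity E (F x) * (fderiv ℝ F x).det := by
  rw [fderiv_comp _ (contDiff_concentratedMap.differentiable one_ne_zero _)
    (hF.differentiable one_ne_zero _)]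
  exact LinearMap.det_comp _ _

theorem degreeIntegral_congr_of_homotopy {F₀ F₁ : E → E} (h₀ : ContDiff ℝ 1 F₀)
    (h₁ : ContDiff ℝ 1 F₁) {Ω : Set E} (hΩ : Bornology.IsBounded Ω) (hΩo : IsOpen Ω)
    (h : ∀ x ∈ frontier Ω, ∀ t ∈ Icc (0 : ℝ) 1, 1 < ‖F₀ x + t • (F₁ x - F₀ x)‖) :
    degreeIntegral μ F₀ Ω = degreeIntegral μ F₁ Ω := by
  set A : Set E := closure Ω ∩
    Prod.fst '' ((closure Ω ×ˢ Icc (0 : ℝ) 1) ∩ {q | ‖F₀ q.1 + q.2 • (F₁ q.1 - F₀ q.1)‖ ≤ 1})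
    with hA
  have hc0 := h₀.continuous
  have hc1 := h₁.continuous
  have hAc : IsCompact A := by
    refine hΩ.isCompact_closure.inter (IsCompact.image ?_ continuous_fst)
    refine (hΩ.isCompact_closure.prod isCompact_Icc).inter_right (isClosed_le ?_ continuous_const)
    fun_prop
  have hAΩ : A ⊆ Ω := by
    rintro _ ⟨hx, ⟨⟨x, t⟩, ⟨⟨-, ht⟩, hle⟩, rfl⟩⟩
    by_contra hxΩ
    have hfr : x ∈ frontier Ω := by rw [hΩo.frontier_eq]; exact ⟨hx, hxΩ⟩
    exact absurd (h x hfr t ht) (not_lt.2 hle)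
  have hnA : ∀ x ∈ Ω, x ∉ A → ∀ t ∈ Icc (0 : ℝ) 1, 1 ≤ ‖F₀ x + t • (F₁ x - F₀ x)‖ := by
    intro x hx hxA t ht
    by_contra! hlt
    exact hxA ⟨subset_closure hx, ⟨(x, t), ⟨⟨subset_closure hx, ht⟩, hlt.le⟩, rfl⟩⟩
  obtain ⟨χ, hχ, hχc, hχΩ, hχI, hχ1⟩ := exists_contDiff_one_near_of_isCompact hAc hΩo hAΩ
  set G : E → E := fun x => F₀ x + χ x • (F₁ x - F₀ x) with hG
  have hGC : ContDiff ℝ 1 G := h₀.add (hχ.smul (h₁.sub h₀))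
  unfold degreeIntegral
  congr 1
  trans ∫ x in Ω, concentratedDensity E (G x) * (fderiv ℝ G x).det ∂μ
  · simp_rw [← det_fderiv_concentratedMap_comp h₀, ← det_fderiv_concentratedMap_comp hGC]
    refine setIntegral_det_fderiv_congr μ (contDiff_concentratedMap.comp h₀)
      (contDiff_concentratedMap.comp hGC) hΩ (Subset.trans (closure_mono ?_) hχΩ)
    intro x hx
    by_contra hx0
    rw [Function.mem_support, not_not] at hx0
    exact hx (by simp [hG, hx0])
  · refine setIntegral_congr_fun hΩo.measurableSet fun x hx => ?_
    by_cases hxA : x ∈ A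
    · have : G =ᶠ[𝓝 x] F₁ := by
        filter_upwards [hχ1 x hxA] with y hy
        simp [hG, hy]
      rw [this.fderiv_eq, this.eq_of_nhds]
    · have e1 : concentratedDensity E (G x) = 0 :=
        concentratedDensity_eq_zero (hnA x hx hxA _ (hχI x))
      have e2 : concentratedDensity E (F₁ x) = 0 :=
        concentratedDensity_eq_zero (by simpa using hnA x hx hxA 1 (by simp))
      simp [e1, e2]

end DegreeIntegral

section WeightedDegree

variable {E : Type*} [NormedAddCommGroup E] [NormedSpace ℝ E] [FiniteDimensional ℝ E]
  [Nontrivial E]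

omit [Nontrivial E] in
theorem det_fderiv_inv_smul_sub_const {F : E → E} (hF : ContDiff ℝ 1 F) (s : ℝ) (x y : E) :
    (fderiv ℝ (fun x => s⁻¹ • (F x - y)) x).det
      = s⁻¹ ^ Module.finrank ℝ E * (fderiv ℝ F x).det := by
  have h : HasFDerivAt (fun x => s⁻¹ • (F x - y)) (s⁻¹ • fderiv ℝ F x) x :=
    ((hF.differentiable one_ne_zero x).hasFDerivAt.sub_const y).const_smul s⁻¹
  rw [h.fderiv]
  exact LinearMap.det_smul _ _

theorem hasCompactSupport_concentratedDensity : HasCompactSupport (concentratedDensity E) := by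
  refine HasCompactSupport.intro (isCompact_closedBall (0 : E) 1) fun x hx => ?_
  refine concentratedDensity_eq_zero ?_
  simp at hx
  exact hx.le

variable [MeasurableSpace E] [BorelSpace E] (μ : Measure E) [μ.IsAddHaarMeasure]

theorem integral_mul_concentratedDensity_comp (ψ : E → ℝ) (a : E) {s : ℝ} (hs : 0 < s) :
    ∫ y, ψ y * (concentratedDensity E (s⁻¹ • (a - y)) * s⁻¹ ^ Module.finrank ℝ E) ∂μ
      = ∫ z in closedBall 0 1, ψ (a - s • z) * concentratedDensity E z ∂μ := by
  have h1 := integral_sub_left_eq_self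
    (fun y => ψ y * (concentratedDensity E (s⁻¹ • (a - y)) * s⁻¹ ^ Module.finrank ℝ E)) μ a
  have h2 := Measure.integral_comp_smul μ
    (fun z => ψ (a - s • z) * (concentratedDensity E z * s⁻¹ ^ Module.finrank ℝ E)) s⁻¹
  rw [← h1]
  simp only [sub_sub_cancel, smul_smul, mul_inv_cancel₀ hs.ne', one_smul] at h2 ⊢
  rw [h2, setIntegral_eq_integral_of_forall_compl_eq_zero, smul_eq_mul, ← integral_const_mul]
  · refine integral_congr_ae (Eventually.of_forall fun z => ?_)
    have : |(s⁻¹ ^ Module.finrank ℝ E)⁻¹| * s⁻¹ ^ Module.finrank ℝ E = 1 := by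
      rw [abs_of_pos (by positivity)]
      field_simp
    simp only
    linear_combination ψ (a - s • z) * concentratedDensity E z * this
  · intro z hz
    rw [concentratedDensity_eq_zero, mul_zero]
    simp at hz
    exact hz.le

/-- Change of variables weighted by the analytic degree. -/
theorem setIntegral_comp_mul_det_fderiv_eq {F : E → E} (hF : ContDiff ℝ 1 F) {Ω : Set E}
    (hΩ : Bornology.IsBounded Ω) {ψ : E → ℝ} (hψ : Continuous ψ)
    (hψc : HasCompactSupport ψ) {c : E → ℝ} {s₀ : ℝ} (hs₀ : 0 < s₀)
    (hc : ∀ y, ψ y ≠ 0 → ∀ s ∈ Ioo 0 s₀,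
      degreeIntegral μ (fun x => s⁻¹ • (F x - y)) Ω = c y) :
    ∫ x in Ω, ψ (F x) * (fderiv ℝ F x).det ∂μ = ∫ y, ψ y * c y ∂μ := by
  set κ := ∫ x, concentratedDensity E x ∂μ with hκ
  have hκ0 : 0 < κ := integral_concentratedDensity_pos μ
  set J : E → ℝ := fun x => (fderiv ℝ F x).det with hJ
  have hJc : Continuous J := hF.continuous_det_fderiv
  have hFc := hF.continuous
  have hρ := continuous_concentratedDensity (E := E)
  set K : ℝ → E → ℝ := fun s x =>
    ∫ z in closedBall 0 1, ψ (F x - s • z) * concentratedDensity E z ∂μ with hK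
  have hKc : Continuous (Function.uncurry K) := by
    have : Continuous (Function.uncurry fun (q : ℝ × E) (z : E) =>
        ψ (F q.2 - q.1 • z) * concentratedDensity E z) := by
      unfold Function.uncurry
      fun_prop
    exact continuous_parametric_integral_of_continuous this (isCompact_closedBall 0 1)
  set Φ : ℝ → ℝ := fun s => ∫ x in Ω, J x * K s x ∂μ with hΦ
  have hΦc : Continuous Φ := by
    have h : Continuous (Function.uncurry fun (s : ℝ) (x : E) => J x * K s x) := by
      unfold Function.uncurry
      exact (hJc.comp continuous_snd).mul hKc
    have h' := continuous_parametric_integral_of_continuous (μ := μ.restrict Ω) h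
      hΩ.isCompact_closure
    rwa [Measure.restrict_restrict isClosed_closure.measurableSet,
      inter_eq_right.2 subset_closure] at h'
  have hΦ0 : Φ 0 = κ * ∫ x in Ω, ψ (F x) * J x ∂μ := by
    rw [← integral_const_mul]
    refine integral_congr_ae (Eventually.of_forall fun x => ?_)
    simp only [hK, zero_smul, sub_zero]
    rw [integral_const_mul, setIntegral_eq_integral_of_forall_compl_eq_zero]
    · ring
    · intro z hz
      rw [concentratedDensity_eq_zero]
      simp at hz
      exact hz.le
  have hΦs : ∀ s ∈ Ioo 0 s₀, Φ s = κ * ∫ y, ψ y * c y ∂μ := by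
    intro s hs
    obtain ⟨B, hB⟩ :=
      (hasCompactSupport_concentratedDensity (E := E)).exists_bound_of_continuous hρ
    have h_int : Integrable (Function.uncurry fun y x =>
        ψ y * (concentratedDensity E (s⁻¹ • (F x - y)) * s⁻¹ ^ Module.finrank ℝ E) * J x)
        (μ.prod (μ.restrict Ω)) := by
      have h1 : Integrable (fun q : E × E => ψ q.1 * J q.2) (μ.prod (μ.restrict Ω)) :=
        (hψ.integrable_of_hasCompactSupport hψc).mul_prod
          (hΩ.integrableOn_of_continuous μ hJc)
      have h2 := h1.bdd_mul (c := B)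
        (f := fun q : E × E => concentratedDensity E (s⁻¹ • (F q.2 - q.1)))
        (Continuous.aestronglyMeasurable (by fun_prop)) (Eventually.of_forall fun q => hB _)
      refine (h2.mul_const (s⁻¹ ^ Module.finrank ℝ E)).congr (Eventually.of_forall fun q => ?_)
      simp only [Function.uncurry]
      ring
    have hsw := integral_integral_swap h_int
    have hL : ∀ y, (∫ x in Ω, ψ y *
        (concentratedDensity E (s⁻¹ • (F x - y)) * s⁻¹ ^ Module.finrank ℝ E) * J x ∂μ)
        = κ * (ψ y * c y) := by
      intro y
      by_cases hy : ψ y = 0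
      · simp [hy]
      rw [← hc y hy s hs, degreeIntegral]
      simp_rw [det_fderiv_inv_smul_sub_const hF]
      rw [← hκ, mul_left_comm, mul_inv_cancel_left₀ hκ0.ne', ← integral_const_mul]
      refine integral_congr_ae (Eventually.of_forall fun x => ?_)
      simp only [hJ]
      ring
    simp_rw [hL, integral_mul_const, integral_mul_concentratedDensity_comp μ ψ _ hs.1,
      integral_const_mul] at hsw
    rw [hsw]
    refine integral_congr_ae (Eventually.of_forall fun x => ?_)
    simp only [hK]
    ring
  have h1 : Tendsto Φ (𝓝[>] 0) (𝓝 (Φ 0)) := hΦc.continuousAt.tendsto.mono_left inf_le_left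
  have h2 : Tendsto Φ (𝓝[>] 0) (𝓝 (κ * ∫ y, ψ y * c y ∂μ)) := by
    refine tendsto_const_nhds.congr' ?_
    filter_upwards [Ioo_mem_nhdsGT hs₀] with s hs
    exact (hΦs s hs).symm
  have := tendsto_nhds_unique h1 h2
  rw [hΦ0] at this
  exact mul_left_cancel₀ hκ0.ne' this

end WeightedDegree

section TopDegree

theorem IsCompact.exists_pos_forall_lt_norm {X F : Type*} [TopologicalSpace X]
    [NormedAddCommGroup F] {K : Set X} (hK : IsCompact K) {g : X → F} (hg : ContinuousOn g K)
    (h0 : ∀ x ∈ K, g x ≠ 0) : ∃ m > 0, ∀ x ∈ K, m < ‖g x‖ := by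
  rcases K.eq_empty_or_nonempty with rfl | hne
  · exact ⟨1, one_pos, by simp⟩
  obtain ⟨x, hx, hmin⟩ := hK.exists_isMinOn hne hg.norm
  have hpos : 0 < ‖g x‖ := norm_pos_iff.2 (h0 x hx)
  exact ⟨‖g x‖ / 2, half_pos hpos, fun y hy => (half_lt_self hpos).trans_le (hmin hy)⟩

theorem Bornology.IsBounded.isCompact_frontier {X : Type*} [PseudoMetricSpace X] [ProperSpace X]
    {Ω : Set X} (hΩ : Bornology.IsBounded Ω) : IsCompact (frontier Ω) :=
  hΩ.isCompact_closure.of_isClosed_subset isClosed_frontier frontier_subset_closure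

theorem norm_convexCombo_le {F : Type*} [NormedAddCommGroup F] [NormedSpace ℝ F] {a b : F}
    {t m : ℝ} (ht : t ∈ Icc (0 : ℝ) 1) (ha : ‖a‖ ≤ m) (hb : ‖b‖ ≤ m) :
    ‖a + t • (b - a)‖ ≤ m := by
  have h : a + t • (b - a) = (1 - t) • a + t • b := by module
  have := (convex_closedBall (0 : F) m) (x := a) (by simpa) (y := b) (by simpa)
    (sub_nonneg.2 ht.2) ht.1 (by ring)
  rw [h]
  simpa using this

variable {E : Type*} [NormedAddCommGroup E] [NormedSpace ℝ E] [FiniteDimensional ℝ E]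

theorem Continuous.exists_contDiff_one_near {F : E → E} (hF : Continuous F) {δ : ℝ}
    (hδ : 0 < δ) : ∃ G : E → E, ContDiff ℝ 1 G ∧ ∀ x, ‖G x - F x‖ < δ := by
  obtain ⟨G, hG, hGF, -⟩ := hF.exists_contDiff_approx 1 (ε := fun _ => δ) continuous_const
    fun _ => hδ
  exact ⟨G, by simpa using hG, fun x => by simpa [dist_eq_norm] using hGF x⟩

variable [Nontrivial E] [MeasurableSpace E] [BorelSpace E] (μ : Measure E) [μ.IsAddHaarMeasure]

omit [Nontrivial E] [MeasurableSpace E] [BorelSpace E] [FiniteDimensional ℝ E] in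
theorem one_lt_norm_inv_smul_combo {a : E} {s s' t : ℝ} (hs : 0 < s) (hs' : 0 < s')
    (ha : s < ‖a‖) (ha' : s' < ‖a‖) (ht : t ∈ Icc (0 : ℝ) 1) :
    1 < ‖s⁻¹ • a + t • (s'⁻¹ • a - s⁻¹ • a)‖ := by
  have h : s⁻¹ • a + t • (s'⁻¹ • a - s⁻¹ • a) = ((1 - t) * s⁻¹ + t * s'⁻¹) • a := by module
  have h1 : 1 < s⁻¹ * ‖a‖ := by rwa [← div_eq_inv_mul, one_lt_div hs]
  have h2 : 1 < s'⁻¹ * ‖a‖ := by rwa [← div_eq_inv_mul, one_lt_div hs']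
  have hp : 0 ≤ (1 - t) * s⁻¹ + t * s'⁻¹ :=
    add_nonneg (mul_nonneg (sub_nonneg.2 ht.2) (by positivity)) (mul_nonneg ht.1 (by positivity))
  rw [h, norm_smul, Real.norm_of_nonneg hp]
  rcases ht.1.eq_or_lt with rfl | h0
  · simpa using h1
  · nlinarith [ht.2]

theorem degreeIntegral_inv_smul_congr {F₀ F₁ : E → E} (h₀ : ContDiff ℝ 1 F₀)
    (h₁ : ContDiff ℝ 1 F₁) {Ω : Set E} (hΩ : Bornology.IsBounded Ω) (hΩo : IsOpen Ω)
    (h : ∀ x ∈ frontier Ω, ∀ t ∈ Icc (0 : ℝ) 1, F₀ x + t • (F₁ x - F₀ x) ≠ 0)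
    {s₀ s₁ : ℝ} (hs₀ : 0 < s₀) (hs₁ : 0 < s₁) (hF₀ : ∀ x ∈ frontier Ω, s₀ < ‖F₀ x‖)
    (hF₁ : ∀ x ∈ frontier Ω, s₁ < ‖F₁ x‖) :
    degreeIntegral μ (fun x => s₀⁻¹ • F₀ x) Ω = degreeIntegral μ (fun x => s₁⁻¹ • F₁ x) Ω := by
  have hc0 := h₀.continuous
  have hc1 := h₁.continuous
  obtain ⟨m, hm, hmF⟩ := (hΩ.isCompact_frontier.prod isCompact_Icc).exists_pos_forall_lt_norm
    (g := fun q : E × ℝ => F₀ q.1 + q.2 • (F₁ q.1 - F₀ q.1))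
    (Continuous.continuousOn (by fun_prop)) (fun q hq => h q.1 hq.1 q.2 hq.2)
  have hm0 : ∀ x ∈ frontier Ω, m < ‖F₀ x‖ := fun x hx => by
    simpa using hmF (x, 0) ⟨hx, by simp⟩
  have hm1 : ∀ x ∈ frontier Ω, m < ‖F₁ x‖ := fun x hx => by
    simpa using hmF (x, 1) ⟨hx, by simp⟩
  have hsm : ∀ {G : E → E} (s : ℝ), ContDiff ℝ 1 G → ContDiff ℝ 1 fun x => s⁻¹ • G x :=
    fun s hG => contDiff_const.smul hG
  trans degreeIntegral μ (fun x => m⁻¹ • F₀ x) Ω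
  · exact degreeIntegral_congr_of_homotopy μ (hsm _ h₀) (hsm _ h₀) hΩ hΩo fun x hx t ht =>
      one_lt_norm_inv_smul_combo hs₀ hm (hF₀ x hx) (hm0 x hx) ht
  trans degreeIntegral μ (fun x => m⁻¹ • F₁ x) Ω
  · refine degreeIntegral_congr_of_homotopy μ (hsm _ h₀) (hsm _ h₁) hΩ hΩo fun x hx t ht => ?_
    have : m⁻¹ • F₀ x + t • (m⁻¹ • F₁ x - m⁻¹ • F₀ x) = m⁻¹ • (F₀ x + t • (F₁ x - F₀ x)) := by
      module
    rw [this, norm_smul, norm_inv, Real.norm_of_nonneg hm.le, ← div_eq_inv_mul, one_lt_div hm]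
    exact hmF (x, t) ⟨hx, ht⟩
  · exact degreeIntegral_congr_of_homotopy μ (hsm _ h₁) (hsm _ h₁) hΩ hΩo fun x hx t ht =>
      one_lt_norm_inv_smul_combo hm hs₁ (hm1 x hx) (hF₁ x hx) ht

/-- `G` is a `C¹` map which, divided by `s`, computes the degree of `F` on `Ω`. -/
def IsDegreeApprox (F : E → E) (Ω : Set E) (G : E → E) (s : ℝ) : Prop :=
  ContDiff ℝ 1 G ∧ 0 < s ∧ ∀ x ∈ frontier Ω, ‖G x - F x‖ + s < ‖F x‖

open Classical in
/-- The Brouwer degree at `0` of a continuous map `F` on a bounded open set `Ω` such that `F`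
does not vanish on the boundary of `Ω`. -/
noncomputable def topDegree (F : E → E) (Ω : Set E) : ℝ :=
  if h : ∃ q : (E → E) × ℝ, IsDegreeApprox F Ω q.1 q.2 then
    degreeIntegral μ (fun x => h.choose.2⁻¹ • h.choose.1 x) Ω else 0

omit [Nontrivial E] [MeasurableSpace E] [BorelSpace E] [FiniteDimensional ℝ E] in
theorem add_smul_sub_ne_zero_of_near {a b c d : E} {m t : ℝ} (ht : t ∈ Icc (0 : ℝ) 1)
    (hm : m ≤ ‖a + t • (b - a)‖) (hc : ‖c - a‖ < m) (hd : ‖d - b‖ < m) :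
    c + t • (d - c) ≠ 0 := by
  intro h0
  have h1 : a + t • (b - a) = -((c - a) + t • ((d - b) - (c - a))) := by
    have : -((c - a) + t • ((d - b) - (c - a))) = a + t • (b - a) - (c + t • (d - c)) := by module
    rw [this, h0, sub_zero]
  have h2 : ‖(c - a) + t • ((d - b) - (c - a))‖ ≤ max ‖c - a‖ ‖d - b‖ :=
    norm_convexCombo_le ht (le_max_left _ _) (le_max_right _ _)
  rw [h1, norm_neg] at hm
  exact absurd (hm.trans h2) (not_le.2 (max_lt hc hd))

theorem IsDegreeApprox.topDegree_eq {F G : E → E} {Ω : Set E} {s : ℝ}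
    (hG : IsDegreeApprox F Ω G s) (hΩ : Bornology.IsBounded Ω) (hΩo : IsOpen Ω) :
    topDegree μ F Ω = degreeIntegral μ (fun x => s⁻¹ • G x) Ω := by
  have hex : ∃ q : (E → E) × ℝ, IsDegreeApprox F Ω q.1 q.2 := ⟨(G, s), hG⟩
  rw [topDegree, dif_pos hex]
  have hlt : ∀ {G : E → E} {s : ℝ}, IsDegreeApprox F Ω G s → ∀ x ∈ frontier Ω, s < ‖G x‖ := by
    intro G s hG x hx
    have h1 := hG.2.2 x hx
    have h2 := norm_sub_norm_le (F x) (F x - G x)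
    rw [sub_sub_cancel, norm_sub_rev] at h2
    linarith
  have h := hex.choose_spec
  refine degreeIntegral_inv_smul_congr μ h.1 hG.1 hΩ hΩo (fun x hx t ht => ?_)
    h.2.1 hG.2.1 (hlt h) (hlt hG)
  refine add_smul_sub_ne_zero_of_near (a := F x) (b := F x) (m := ‖F x‖) ht (by simp) ?_ ?_
  · linarith [h.2.2 x hx, h.2.1]
  · linarith [hG.2.2 x hx, hG.2.1]

/-- Homotopy invariance of the degree for straight-line homotopies. -/
theorem topDegree_congr_of_homotopy {F₀ F₁ : E → E} {Ω : Set E} (h₀ : Continuous F₀)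
    (h₁ : Continuous F₁) (hΩ : Bornology.IsBounded Ω) (hΩo : IsOpen Ω)
    (h : ∀ x ∈ frontier Ω, ∀ t ∈ Icc (0 : ℝ) 1, F₀ x + t • (F₁ x - F₀ x) ≠ 0) :
    topDegree μ F₀ Ω = topDegree μ F₁ Ω := by
  obtain ⟨m, hm, hmF⟩ := (hΩ.isCompact_frontier.prod isCompact_Icc).exists_pos_forall_lt_norm
    (g := fun q : E × ℝ => F₀ q.1 + q.2 • (F₁ q.1 - F₀ q.1))
    (Continuous.continuousOn (by fun_prop)) (fun q hq => h q.1 hq.1 q.2 hq.2)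
  have hm0 : ∀ x ∈ frontier Ω, m < ‖F₀ x‖ := fun x hx => by
    simpa using hmF (x, 0) ⟨hx, by simp⟩
  have hm1 : ∀ x ∈ frontier Ω, m < ‖F₁ x‖ := fun x hx => by
    simpa using hmF (x, 1) ⟨hx, by simp⟩
  obtain ⟨G₀, hG₀, hGF₀⟩ := h₀.exists_contDiff_one_near (half_pos hm)
  obtain ⟨G₁, hG₁, hGF₁⟩ := h₁.exists_contDiff_one_near (half_pos hm)
  have a₀ : IsDegreeApprox F₀ Ω G₀ (m / 2) :=
    ⟨hG₀, half_pos hm, fun x hx => by linarith [hm0 x hx, hGF₀ x]⟩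
  have a₁ : IsDegreeApprox F₁ Ω G₁ (m / 2) :=
    ⟨hG₁, half_pos hm, fun x hx => by linarith [hm1 x hx, hGF₁ x]⟩
  rw [a₀.topDegree_eq μ hΩ hΩo, a₁.topDegree_eq μ hΩ hΩo]
  refine degreeIntegral_inv_smul_congr μ hG₀ hG₁ hΩ hΩo (fun x hx t ht => ?_)
    (half_pos hm) (half_pos hm) (fun x hx => ?_) (fun x hx => ?_)
  · exact add_smul_sub_ne_zero_of_near ht (hmF (x, t) ⟨hx, ht⟩).le
      ((hGF₀ x).trans (half_lt_self hm)) ((hGF₁ x).trans (half_lt_self hm))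
  · have h2 := norm_sub_norm_le (F₀ x) (F₀ x - G₀ x)
    rw [sub_sub_cancel, norm_sub_rev] at h2
    linarith [hm0 x hx, hGF₀ x]
  · have h2 := norm_sub_norm_le (F₁ x) (F₁ x - G₁ x)
    rw [sub_sub_cancel, norm_sub_rev] at h2
    linarith [hm1 x hx, hGF₁ x]

theorem topDegree_eq_zero {F : E → E} {Ω : Set E} (hF : Continuous F)
    (hΩ : Bornology.IsBounded Ω) (hΩo : IsOpen Ω) (h : ∀ x ∈ closure Ω, F x ≠ 0) :
    topDegree μ F Ω = 0 := by
  obtain ⟨m, hm, hmF⟩ := hΩ.isCompact_closure.exists_pos_forall_lt_norm hF.continuousOn h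
  obtain ⟨G, hG, hGF⟩ := hF.exists_contDiff_one_near (half_pos hm)
  have a : IsDegreeApprox F Ω G (m / 2) := ⟨hG, half_pos hm, fun x hx => by
    linarith [hmF x (frontier_subset_closure hx), hGF x]⟩
  rw [a.topDegree_eq μ hΩ hΩo, degreeIntegral,
    setIntegral_eq_zero_of_forall_eq_zero, mul_zero]
  intro x hx
  rw [concentratedDensity_eq_zero, zero_mul]
  have h2 := norm_sub_norm_le (F x) (F x - G x)
  rw [sub_sub_cancel, norm_sub_rev] at h2
  rw [norm_smul, norm_inv, Real.norm_of_nonneg (half_pos hm).le, ← div_eq_inv_mul,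
    one_le_div (half_pos hm)]
  linarith [hmF x (subset_closure hx), hGF x]

theorem topDegree_sub_const_eq_one {Ω : Set E} (hΩ : Bornology.IsBounded Ω) (hΩo : IsOpen Ω)
    {y : E} (hy : y ∈ Ω) : topDegree μ (fun x => x - y) Ω = 1 := by
  obtain ⟨s, hs, hsΩ⟩ := Metric.isOpen_iff.1 hΩo y hy
  have hfar : ∀ x, x ∉ Ω → s / 2 < ‖x - y‖ := fun x hx => by
    by_contra! h
    exact hx (hsΩ (by rw [mem_ball, dist_eq_norm]; linarith))
  have a : IsDegreeApprox (fun x => x - y) Ω (fun x => x - y) (s / 2) :=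
    ⟨contDiff_id.sub contDiff_const, half_pos hs, fun x hx => by
      simpa using hfar x (by rw [hΩo.frontier_eq] at hx; exact hx.2)⟩
  rw [a.topDegree_eq μ hΩ hΩo, degreeIntegral]
  have hdet : ∀ x, (fderiv ℝ (fun x => (s / 2)⁻¹ • (x - y)) x).det
      = (s / 2)⁻¹ ^ Module.finrank ℝ E := fun x => by
    rw [det_fderiv_inv_smul_sub_const (F := fun x => x) contDiff_id]
    rw [fderiv_fun_id, ContinuousLinearMap.det]
    simp
  simp_rw [hdet, integral_mul_const]
  rw [setIntegral_eq_integral_of_forall_compl_eq_zero,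
    integral_sub_right_eq_self (fun x => concentratedDensity E ((s / 2)⁻¹ • x)) y,
    Measure.integral_comp_smul, smul_eq_mul, abs_of_pos (by positivity)]
  · have := (integral_concentratedDensity_pos μ).ne'
    field_simp
  · intro x hx
    rw [concentratedDensity_eq_zero]
    rw [norm_smul, norm_inv, Real.norm_of_nonneg (half_pos hs).le, ← div_eq_inv_mul,
      one_le_div (half_pos hs)]
    exact (hfar x hx).le

/-- The degree of a composition, when the inner degree takes a single nonzero value. -/
theorem topDegree_comp {g h : E → E} (hg : Continuous g) (hh : Continuous h) {Ω V₀ V₁ : Set E}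
    (hΩ : Bornology.IsBounded Ω) (hΩo : IsOpen Ω) (hV₁ : Bornology.IsBounded V₁)
    (hV₁o : IsOpen V₁) (hV₀o : IsOpen V₀) (hdisj : Disjoint V₀ V₁)
    (hfr : ∀ x ∈ frontier Ω, g x ∉ V₀ ∪ V₁) {c : ℝ}
    (hc₁ : ∀ y ∈ V₁, topDegree μ (fun x => g x - y) Ω = c)
    (hc₀ : ∀ y ∈ V₀, topDegree μ (fun x => g x - y) Ω = 0)
    (hzero : ∀ y, h y = 0 → y ∈ V₀ ∪ V₁) :
    topDegree μ (h ∘ g) Ω = c * topDegree μ h V₁ := by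
  obtain ⟨R, hR⟩ := (((hΩ.isCompact_closure.image hg).isBounded).union hV₁).subset_closedBall
    (0 : E)
  set B : Set E := closedBall 0 (R + 2)
  have hBc : IsCompact B := isCompact_closedBall 0 (R + 2)
  have hRB : closedBall (0 : E) R ⊆ B := closedBall_subset_closedBall (by linarith)
  have hgR : ∀ x ∈ closure Ω, g x ∈ closedBall (0 : E) R := fun x hx =>
    hR (Or.inl (mem_image_of_mem g hx))
  have hfrV₁ : ∀ y ∈ frontier V₁, y ∈ closedBall (0 : E) R ∧ y ∉ V₀ ∪ V₁ := by
    intro y hy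
    rw [hV₁o.frontier_eq] at hy
    refine ⟨closure_minimal (fun z hz => hR (Or.inr hz)) isClosed_closedBall hy.1, ?_⟩
    rintro (h0 | h1)
    · exact (hdisj.closure_right hV₀o).le_bot ⟨h0, hy.1⟩
    · exact hy.2 h1
  obtain ⟨m, hm, hmh⟩ := (hBc.diff (hV₀o.union hV₁o)).exists_pos_forall_lt_norm
    hh.continuousOn (fun y hy h0 => hy.2 (hzero y h0))
  obtain ⟨k, hk, hkh⟩ := hh.exists_contDiff_one_near (half_pos hm)
  set A : Set E := B ∩ {y | ‖k y‖ ≤ m / 4}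
  have hAc : IsCompact A := hBc.inter_right (isClosed_le hk.continuous.norm continuous_const)
  have hAV : A ⊆ V₀ ∪ V₁ := by
    intro y hy
    by_contra hyV
    have h1 := hmh y ⟨hy.1, hyV⟩
    have h2 := norm_sub_norm_le (h y) (h y - k y)
    rw [sub_sub_cancel, norm_sub_rev] at h2
    have h3 : ‖k y‖ ≤ m / 4 := hy.2
    linarith [hkh y]
  obtain ⟨η₁, hη₁, hη₁g⟩ := (hΩ.isCompact_frontier.prod hAc).exists_pos_forall_lt_norm
    (g := fun q : E × E => g q.1 - q.2) (Continuous.continuousOn (by fun_prop))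
    (fun q hq h0 => hfr q.1 hq.1 (by rw [sub_eq_zero.1 h0]; exact hAV hq.2))
  obtain ⟨η₂, hη₂, hη₂h⟩ := Metric.uniformContinuousOn_iff.1
    (hBc.uniformContinuousOn_of_continuous hh.continuousOn) (m / 4) (by positivity)
  obtain ⟨u, hu, hug⟩ := hg.exists_contDiff_one_near
    (δ := min 1 (min (η₁ / 2) η₂)) (by positivity)
  have hug1 : ∀ x, ‖u x - g x‖ < 1 := fun x => (hug x).trans_le (min_le_left _ _)
  have hug2 : ∀ x, ‖u x - g x‖ < η₁ / 2 := fun x =>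
    (hug x).trans_le ((min_le_right _ _).trans (min_le_left _ _))
  have hug3 : ∀ x, ‖u x - g x‖ < η₂ := fun x =>
    (hug x).trans_le ((min_le_right _ _).trans (min_le_right _ _))
  have huR : ∀ x ∈ closure Ω, u x ∈ closedBall (0 : E) (R + 1) := fun x hx => by
    have h1 := hgR x hx
    rw [mem_closedBall_zero_iff] at h1 ⊢
    have h2 := norm_le_norm_add_norm_sub' (u x) (g x)
    linarith [hug1 x]
  set s : ℝ := m / 8
  have hs : 0 < s := by positivity
  have ah : IsDegreeApprox h V₁ k s := ⟨hk, hs, fun y hy => by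
    have := hmh y ⟨hRB (hfrV₁ y hy).1, (hfrV₁ y hy).2⟩
    simp only [s]
    linarith [hkh y]⟩
  have ahg : IsDegreeApprox (h ∘ g) Ω (k ∘ u) s := ⟨hk.comp hu, hs, fun x hx => by
    have hxc := frontier_subset_closure hx
    have h1 := hmh (g x) ⟨hRB (hgR x hxc), hfr x hx⟩
    have h2 := hη₂h (u x) (closedBall_subset_closedBall (by linarith) (huR x hxc)) (g x)
      (hRB (hgR x hxc)) (by rw [dist_eq_norm]; exact hug3 x)
    rw [dist_eq_norm] at h2
    have h3 := norm_sub_le_norm_sub_add_norm_sub (k (u x)) (h (u x)) (h (g x))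
    simp only [s, Function.comp]
    linarith [hkh (u x)]⟩
  have agy : ∀ y ∈ A, ∀ σ ∈ Ioo 0 (η₁ / 2),
      IsDegreeApprox (fun x => g x - y) Ω (fun x => u x - y) σ := fun y hy σ hσ =>
    ⟨hu.sub contDiff_const, hσ.1, fun x hx => by
      have := hη₁g (x, y) ⟨hx, hy⟩
      simp only [sub_sub_sub_cancel_right] at this ⊢
      linarith [hug2 x, hσ.2]⟩
  obtain ⟨χ, hχ, hχc, hχB, -, hχ1⟩ := exists_contDiff_one_near_of_isCompact
    (isCompact_closedBall (0 : E) (R + 1)) (isOpen_ball (x := (0 : E)) (ε := R + 2))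
    (closedBall_subset_ball (by linarith))
  set q : E → E := fun y => s⁻¹ • k y
  have hq : ContDiff ℝ 1 q := contDiff_const.smul hk
  set ψ : E → ℝ := fun y => χ y * (concentratedDensity E (q y) * (fderiv ℝ q y).det)
  have hψ : Continuous ψ := hχ.continuous.mul
    ((continuous_concentratedDensity.comp hq.continuous).mul hq.continuous_det_fderiv)
  have hψA : ∀ y, ψ y ≠ 0 → y ∈ A := by
    intro y hy
    have h1 : χ y ≠ 0 := left_ne_zero_of_mul hy
    have h2 : concentratedDensity E (q y) ≠ 0 :=
      left_ne_zero_of_mul (right_ne_zero_of_mul hy)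
    refine ⟨ball_subset_closedBall (hχB (subset_closure h1)), ?_⟩
    have h3 : ‖q y‖ < 1 := by
      by_contra! h
      exact h2 (concentratedDensity_eq_zero h)
    rw [norm_smul, norm_inv, Real.norm_of_nonneg hs.le, ← div_eq_inv_mul, div_lt_one hs] at h3
    simp only [s] at h3
    change ‖k y‖ ≤ m / 4
    linarith
  have hW := setIntegral_comp_mul_det_fderiv_eq μ hu hΩ hψ
    (hχc.mul_right) (c := V₁.indicator fun _ => c) (half_pos hη₁) (by
      intro y hy σ hσ
      have hyA := hψA y hy
      rw [← (agy y hyA σ hσ).topDegree_eq μ hΩ hΩo]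
      by_cases hy1 : y ∈ V₁
      · rw [hc₁ y hy1, indicator_of_mem hy1]
      · rw [hc₀ y ((hAV hyA).resolve_right hy1), indicator_of_notMem hy1])
  rw [ah.topDegree_eq μ hV₁ hV₁o, ahg.topDegree_eq μ hΩ hΩo, degreeIntegral, degreeIntegral,
    mul_left_comm]
  congr 1
  have e1 : ∫ x in Ω, concentratedDensity E (s⁻¹ • (k ∘ u) x)
      * (fderiv ℝ (fun x => s⁻¹ • (k ∘ u) x) x).det ∂μ
      = ∫ x in Ω, ψ (u x) * (fderiv ℝ u x).det ∂μ := by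
    refine setIntegral_congr_fun hΩo.measurableSet fun x hx => ?_
    have h1 : χ (u x) = 1 := (hχ1 _ (huR x (subset_closure hx))).eq_of_nhds
    have h2 : (fderiv ℝ (fun x => s⁻¹ • (k ∘ u) x) x).det
        = (fderiv ℝ q (u x)).det * (fderiv ℝ u x).det := by
      have : (fun x => s⁻¹ • (k ∘ u) x) = q ∘ u := rfl
      rw [this, fderiv_comp _ (hq.differentiable one_ne_zero _)
        (hu.differentiable one_ne_zero _)]
      exact LinearMap.det_comp _ _
    simp only [ψ, h1, h2, one_mul, mul_assoc]
    rfl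
  rw [e1, hW, ← integral_const_mul, ← integral_indicator hV₁o.measurableSet]
  refine integral_congr_ae (Eventually.of_forall fun y => ?_)
  by_cases hy : y ∈ V₁
  · have h1 : χ y = 1 := (hχ1 _ (closedBall_subset_closedBall (by linarith)
      (hR (Or.inr hy)))).eq_of_nhds
    simp only [indicator_of_mem hy, ψ, h1, one_mul, q]
    ring
  · simp [indicator_of_notMem hy]

end TopDegree

section Extension

theorem exists_continuous_extension_of_isClosed {X F : Type*} [TopologicalSpace X]
    [NormalSpace X] [NormedAddCommGroup F] [NormedSpace ℝ F] [FiniteDimensional ℝ F] {K : Set X}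
    (hK : IsClosed K) {g : X → F} (hg : ContinuousOn g K) :
    ∃ G : X → F, Continuous G ∧ EqOn G g K := by
  obtain ⟨G, hG⟩ := ContinuousMap.exists_restrict_eq hK ⟨K.domRestrict g, hg.domRestrict⟩
  exact ⟨G, G.continuous, fun x hx => DFunLike.congr_fun hG ⟨x, hx⟩⟩

theorem IsCompact.exists_continuous_factor {X Z F : Type*} [TopologicalSpace X]
    [TopologicalSpace Z] [T4Space Z] [NormedAddCommGroup F] [NormedSpace ℝ F]
    [FiniteDimensional ℝ F] {K : Set X} (hK : IsCompact K) {f : X → Z} (hf : ContinuousOn f K)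
    (hinj : InjOn f K) {u : X → F} (hu : ContinuousOn u K) :
    ∃ G : Z → F, Continuous G ∧ ∀ x ∈ K, G (f x) = u x := by
  have : CompactSpace K := isCompact_iff_compactSpace.1 hK
  obtain ⟨G, hG⟩ := ContinuousMap.exists_extension'
    (hf.domRestrict.isClosedEmbedding hinj.injective) ⟨K.domRestrict u, hu.domRestrict⟩
  exact ⟨G, G.continuous, fun x hx => congrFun hG ⟨x, hx⟩⟩

theorem Convex.exists_continuous_retraction {F : Type*} [NormedAddCommGroup F]
    [InnerProductSpace ℝ F] [CompleteSpace F] {C : Set F} (hC : Convex ℝ C) (hCc : IsClosed C)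
    (hne : C.Nonempty) :
    ∃ R : F → F, Continuous R ∧ (∀ x, R x ∈ C) ∧ ∀ x ∈ C, R x = x := by
  choose R hRC hR using exists_norm_eq_iInf_of_complete_convex hne hCc.isComplete hC
  have hR' : ∀ x, ∀ w ∈ C, ⟪x - R x, w - R x⟫ ≤ 0 := fun x =>
    (norm_eq_iInf_iff_real_inner_le_zero hC (hRC x)).1 (hR x)
  refine ⟨R, ?_, hRC, fun x hx => ?_⟩
  · refine (LipschitzWith.of_dist_le_mul (K := 1) fun x y => ?_).continuous
    rw [dist_eq_norm, dist_eq_norm, NNReal.coe_one, one_mul]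
    have h1 := hR' x (R y) (hRC y)
    have h2 := hR' y (R x) (hRC x)
    have h3 := real_inner_le_norm (x - y) (R x - R y)
    have h4 : ‖R x - R y‖ * ‖R x - R y‖ ≤ ⟪x - y, R x - R y⟫ := by
      rw [← real_inner_self_eq_norm_mul_norm]
      have e : ⟪x - y, R x - R y⟫ - ⟪R x - R y, R x - R y⟫
          = -⟪x - R x, R y - R x⟫ - ⟪y - R y, R x - R y⟫ := by
        rw [← inner_sub_left, ← inner_neg_right, neg_sub, ← inner_sub_left]
        congr 1
        abel
      linarith
    by_contra! hlt
    nlinarith [norm_nonneg (x - y)]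
  · have h := hR' x x hx
    rw [real_inner_self_nonpos, sub_eq_zero] at h
    exact h.symm

end Extension

section DegreeSub

variable {E : Type*} [NormedAddCommGroup E] [NormedSpace ℝ E] [FiniteDimensional ℝ E]
  [Nontrivial E] [MeasurableSpace E] [BorelSpace E] (μ : Measure E) [μ.IsAddHaarMeasure]

theorem topDegree_sub_congr_of_notMem_segment {F₀ F₁ : E → E} {Ω : Set E} (h₀ : Continuous F₀)
    (h₁ : Continuous F₁) (hΩ : Bornology.IsBounded Ω) (hΩo : IsOpen Ω) {y : E}
    (h : ∀ x ∈ frontier Ω, y ∉ segment ℝ (F₀ x) (F₁ x)) :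
    topDegree μ (fun x => F₀ x - y) Ω = topDegree μ (fun x => F₁ x - y) Ω := by
  refine topDegree_congr_of_homotopy μ (h₀.sub continuous_const) (h₁.sub continuous_const) hΩ hΩo
    fun x hx t ht h0 => h x hx ?_
  rw [segment_eq_image']
  refine ⟨t, ht, ?_⟩
  rw [← sub_eq_zero, ← h0]
  module

theorem eventually_topDegree_sub_eq {F : E → E} {Ω : Set E} (hF : Continuous F)
    (hΩ : Bornology.IsBounded Ω) (hΩo : IsOpen Ω) {y : E} (hy : y ∉ F '' frontier Ω) :
    ∀ᶠ z in 𝓝 y, topDegree μ (fun x => F x - z) Ω = topDegree μ (fun x => F x - y) Ω := by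
  have hc : IsClosed (F '' frontier Ω) := (hΩ.isCompact_frontier.image hF).isClosed
  obtain ⟨δ, hδ, hδy⟩ := Metric.isOpen_iff.1 hc.isOpen_compl y hy
  filter_upwards [ball_mem_nhds y hδ] with z hz
  refine topDegree_congr_of_homotopy μ (hF.sub continuous_const) (hF.sub continuous_const) hΩ hΩo
    fun x hx t ht h0 => ?_
  have hmem : F x ∈ segment ℝ z y := by
    rw [segment_eq_image']
    refine ⟨t, ht, ?_⟩
    simp only
    rw [← sub_eq_zero, ← neg_eq_zero, ← h0]
    module
  exact hδy ((convex_ball y δ).segment_subset hz (mem_ball_self hδ) hmem) ⟨x, hx, rfl⟩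

theorem topDegree_sub_eq_of_isPreconnected {F : E → E} {Ω U : Set E} (hF : Continuous F)
    (hΩ : Bornology.IsBounded Ω) (hΩo : IsOpen Ω) (hU : IsPreconnected U)
    (hUF : ∀ x ∈ frontier Ω, F x ∉ U) {y z : E} (hy : y ∈ U) (hz : z ∈ U) :
    topDegree μ (fun x => F x - y) Ω = topDegree μ (fun x => F x - z) Ω := by
  refine hU.induction₂
    (fun y z => topDegree μ (fun x => F x - y) Ω = topDegree μ (fun x => F x - z) Ω)
    (fun y hy => ?_) (fun _ _ _ _ _ _ h1 h2 => h1.trans h2) (fun _ _ _ _ h => h.symm) hy hz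
  refine mem_nhdsWithin_of_mem_nhds ?_
  filter_upwards [eventually_topDegree_sub_eq μ hF hΩ hΩo (y := y)
    (by rintro ⟨x, hx, rfl⟩; exact hUF x hx hy)] with z hz
  exact hz.symm

theorem topDegree_sub_eq_zero {F : E → E} {Ω : Set E} (hF : Continuous F)
    (hΩ : Bornology.IsBounded Ω) (hΩo : IsOpen Ω) {y : E} (h : ∀ x ∈ closure Ω, F x ≠ y) :
    topDegree μ (fun x => F x - y) Ω = 0 :=
  topDegree_eq_zero μ (hF.sub continuous_const) hΩ hΩo fun x hx => sub_ne_zero.2 (h x hx)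

theorem topDegree_sub_eq_zero_of_convex {F : E → E} {Ω C : Set E} (hF : Continuous F)
    (hΩ : Bornology.IsBounded Ω) (hΩo : IsOpen Ω) (hC : Convex ℝ C) {b : E} (hb : b ∈ C)
    (hFC : ∀ x ∈ frontier Ω, F x ∈ C) {y : E} (hy : y ∉ C) :
    topDegree μ (fun x => F x - y) Ω = 0 := by
  rw [topDegree_sub_congr_of_notMem_segment μ hF (continuous_const (y := b)) hΩ hΩo
    fun x hx h => hy (hC.segment_subset (hFC x hx) hb h)]
  exact topDegree_sub_eq_zero μ continuous_const hΩ hΩo fun x _ h => hy (h ▸ hb)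

end DegreeSub

section CutBall

variable {E : Type*} [NormedAddCommGroup E] [InnerProductSpace ℝ E]

/-- The unit ball with the part beyond the hyperplane `⟪·, p⟫ = c` cut off. -/
def cutBall (p : E) (c : ℝ) : Set E := closedBall 0 1 ∩ {x | ⟪x, p⟫ ≤ c}

/-- The part of the open unit ball strictly beyond the hyperplane `⟪·, p⟫ = c`. -/
def openLens (p : E) (c : ℝ) : Set E := ball 0 1 ∩ {x | c < ⟪x, p⟫}

theorem convex_cutBall (p : E) (c : ℝ) : Convex ℝ (cutBall p c) := by
  refine (convex_closedBall _ _).inter ?_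
  exact convex_halfSpace_le (f := fun x => ⟪x, p⟫)
    ⟨fun x y => inner_add_left x y p, fun a x => real_inner_smul_left x p a⟩ c

theorem convex_openLens (p : E) (c : ℝ) : Convex ℝ (openLens p c) := by
  refine (convex_ball _ _).inter ?_
  exact convex_halfSpace_gt (f := fun x => ⟪x, p⟫)
    ⟨fun x y => inner_add_left x y p, fun a x => real_inner_smul_left x p a⟩ c

theorem isClosed_cutBall (p : E) (c : ℝ) : IsClosed (cutBall p c) :=
  isClosed_closedBall.inter (isClosed_le (by fun_prop) continuous_const)

theorem isOpen_openLens (p : E) (c : ℝ) : IsOpen (openLens p c) :=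
  isOpen_ball.inter (isOpen_lt continuous_const (by fun_prop))

theorem isBounded_openLens (p : E) (c : ℝ) : Bornology.IsBounded (openLens p c) :=
  isBounded_ball.subset inter_subset_left

theorem zero_mem_cutBall (p : E) {c : ℝ} (hc : 0 ≤ c) : (0 : E) ∈ cutBall p c := by
  simp [cutBall, hc]

theorem openLens_nonempty {p : E} {c : ℝ} (hp : ‖p‖ = 1) (hc0 : 0 ≤ c) (hc1 : c < 1) :
    (openLens p c).Nonempty := by
  refine ⟨((c + 1) / 2) • p, ?_, ?_⟩
  · rw [mem_ball_zero_iff, norm_smul, hp, Real.norm_of_nonneg (by linarith)]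
    linarith
  · change c < ⟪((c + 1) / 2) • p, p⟫
    rw [real_inner_smul_left, real_inner_self_eq_norm_sq, hp]
    linarith

theorem notMem_openLens_of_mem_cutBall {p : E} {c : ℝ} {x : E} (hx : x ∈ cutBall p c) :
    x ∉ openLens p c := fun h =>
  not_lt.2 (show ⟪x, p⟫ ≤ c from hx.2) (show c < ⟪x, p⟫ from h.2)

theorem notMem_openLens_of_norm {p : E} {c : ℝ} {x : E} (hx : ‖x‖ = 1) :
    x ∉ openLens p c := fun h => by
  have := mem_ball_zero_iff.1 h.1
  linarith

end CutBall

section LocalInverse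

variable {E : Type*} [NormedAddCommGroup E] [InnerProductSpace ℝ E] [FiniteDimensional ℝ E]

/-- The closed spherical cap around `p`. -/
def sphericalCap (p : E) (c : ℝ) : Set (sphere (0 : E) 1) := {x | c ≤ ⟪(x : E), p⟫}

omit [FiniteDimensional ℝ E] in
theorem isClosed_sphericalCap (p : E) (c : ℝ) : IsClosed (sphericalCap p c) :=
  isClosed_le continuous_const (by fun_prop)

omit [FiniteDimensional ℝ E] in
theorem mem_cutBall_of_sphere {p : E} {c : ℝ} (x : sphere (0 : E) 1) (hx : ⟪(x : E), p⟫ ≤ c) :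
    (x : E) ∈ cutBall p c := ⟨sphere_subset_closedBall x.2, hx⟩

/-- Gluing: a map given on a closed set `K`, corrected by a retraction on a closed set `L`. -/
theorem exists_continuous_eqOn_mapsTo {X : Type*} [TopologicalSpace X] [NormalSpace X]
    {K L : Set X} (hK : IsClosed K) (hL : IsClosed L) {G : X → E} (hG : Continuous G)
    {C : Set E} (hC : Convex ℝ C) (hCc : IsClosed C) (hne : C.Nonempty)
    (hKL : ∀ x ∈ K, x ∈ L → G x ∈ C) :
    ∃ g : X → E, Continuous g ∧ EqOn g G K ∧ MapsTo g L C := by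
  obtain ⟨R, hR, hRC, hRid⟩ := hC.exists_continuous_retraction hCc hne
  classical
  set g₀ : X → E := fun x => if x ∈ L then R (G x) else G x with hg₀
  have hgL : EqOn g₀ (R ∘ G) L := fun x hx => by simp [hg₀, hx]
  have hgK : EqOn g₀ G K := fun x hx => by
    by_cases hxL : x ∈ L
    · rw [hgL hxL]
      exact hRid _ (hKL x hx hxL)
    · simp [hg₀, hxL]
  have hcont : ContinuousOn g₀ (K ∪ L) :=
    (hG.continuousOn.congr hgK).union_of_isClosed ((hR.comp hG).continuousOn.congr hgL) hK hL
  obtain ⟨g, hg, hgg⟩ := exists_continuous_extension_of_isClosed (hK.union hL) hcont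
  exact ⟨g, hg, fun x hx => (hgg (Or.inl hx)).trans (hgK hx), fun x hx => by
    rw [hgg (Or.inr hx), hgL hx]
    exact hRC _⟩

theorem exists_continuous_local_inverse {p : E} {c : ℝ} (hc : 0 ≤ c)
    {f : sphere (0 : E) 1 → E} (hf : Continuous f) (hinj : InjOn f (sphericalCap p c))
    {L : Set E} (hL : IsClosed L) (hfL : ∀ x ∈ sphericalCap p c, f x ∈ L → ⟪(x : E), p⟫ = c) :
    ∃ g : E → E, Continuous g ∧ (∀ x ∈ sphericalCap p c, g (f x) = x) ∧
      MapsTo g L (cutBall p c) := by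
  have hN := (isClosed_sphericalCap p c).isCompact
  obtain ⟨G, hG, hGf⟩ := hN.exists_continuous_factor hf.continuousOn hinj
    continuous_subtype_val.continuousOn
  obtain ⟨g, hg, hgG, hgL⟩ := exists_continuous_eqOn_mapsTo (hN.image hf).isClosed hL hG
    (convex_cutBall p c) (isClosed_cutBall p c) ⟨0, zero_mem_cutBall p hc⟩ (by
      rintro _ ⟨x, hx, rfl⟩ hxL
      rw [hGf x hx]
      exact mem_cutBall_of_sphere x (hfL x hx hxL).le)
  exact ⟨g, hg, fun x hx => (hgG (mem_image_of_mem f hx)).trans (hGf x hx), hgL⟩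

variable [Nontrivial E] [MeasurableSpace E] [BorelSpace E] (μ : Measure E) [μ.IsAddHaarMeasure]

/-- A spherical map which is injective on a cap winds around some point off its image. -/
theorem exists_topDegree_ne_zero {p : E} (hp : ‖p‖ = 1) {c : ℝ} (hc0 : 0 ≤ c) (hc1 : c < 1)
    {f : sphere (0 : E) 1 → E} (hf : Continuous f) (hinj : InjOn f (sphericalCap p c))
    {L : Set E} (hL : IsClosed L) (hfL : ∀ x ∈ sphericalCap p c, f x ∈ L → ⟪(x : E), p⟫ = c)
    (hfL' : ∀ x, x ∉ sphericalCap p c → f x ∈ L) {F : E → E} (hF : Continuous F)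
    (hFf : ∀ x : sphere (0 : E) 1, F x = f x) :
    ∃ y, y ∉ L ∧ y ∉ range f ∧ topDegree μ (fun x => F x - y) (ball 0 1) ≠ 0 := by
  by_contra! hall
  obtain ⟨g, hg, hgf, hgL⟩ := exists_continuous_local_inverse hc0 hf hinj hL hfL
  obtain ⟨z, hz⟩ := openLens_nonempty hp hc0 hc1
  have hfr : frontier (ball (0 : E) 1) = sphere 0 1 := frontier_ball _ one_ne_zero
  have hcomp := topDegree_comp μ hF (h := fun x => g x - z) (by fun_prop)
    (Ω := ball 0 1) (V₀ := (L ∪ range f)ᶜ) (V₁ := ∅) isBounded_ball isOpen_ball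
    Bornology.isBounded_empty isOpen_empty
    (hL.union (isCompact_range hf).isClosed).isOpen_compl (by simp) (c := 0)
    (fun x hx => by
      rw [hfr] at hx
      rw [hFf ⟨x, hx⟩]
      simp) (by simp)
    (fun y hy => by
      rw [mem_compl_iff, mem_union, not_or] at hy
      exact hall y hy.1 hy.2)
    (fun y hy => by
      left
      rw [sub_eq_zero] at hy
      rintro (h | ⟨x, rfl⟩)
      · exact notMem_openLens_of_mem_cutBall (hgL h) (hy ▸ hz)
      · by_cases hx : x ∈ sphericalCap p c
        · rw [hgf x hx] at hy
          exact notMem_openLens_of_norm (mem_sphere_zero_iff_norm.1 x.2) (hy ▸ hz)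
        · exact notMem_openLens_of_mem_cutBall (hgL (hfL' x hx)) (hy ▸ hz))
  rw [zero_mul] at hcomp
  have hone := topDegree_sub_const_eq_one μ isBounded_ball isOpen_ball hz.1
  have heq := topDegree_sub_congr_of_notMem_segment μ (hg.comp hF) continuous_id
    (isBounded_ball (x := (0 : E)) (r := 1)) isOpen_ball (y := z) (fun x hx hmem => by
      rw [hfr] at hx
      simp only [Function.comp, id, hFf ⟨x, hx⟩] at hmem
      by_cases hxc : (⟨x, hx⟩ : sphere (0 : E) 1) ∈ sphericalCap p c
      · rw [hgf _ hxc, segment_same, mem_singleton_iff] at hmem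
        exact notMem_openLens_of_norm (mem_sphere_zero_iff_norm.1 hx) (hmem ▸ hz)
      · exact notMem_openLens_of_mem_cutBall ((convex_cutBall p c).segment_subset
          (hgL (hfL' _ hxc)) (mem_cutBall_of_sphere ⟨x, hx⟩ (not_le.1 hxc).le) hmem) hz)
  have : (1 : ℝ) = 0 := hone.symm.trans (heq.symm.trans hcomp)
  exact one_ne_zero this

/-- A closed ball does not embed in the unit sphere of the same ambient space. -/
theorem not_exists_leftInverse_sphere {u h : E → E} (hu : Continuous u) (hh : Continuous h)
    (b : E) {δ : ℝ} (hδ : 0 < δ) (hu1 : ∀ x ∈ closedBall b δ, ‖u x‖ = 1) :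
    ¬ ∀ x ∈ closedBall b δ, h (u x) = x := by
  intro hinv
  set μ : Measure E := Measure.addHaar
  have hcl : closure (ball b δ) = closedBall b δ := closure_ball b hδ.ne'
  have hfr : frontier (ball b δ) = sphere b δ := frontier_ball b hδ.ne'
  have hcf : IsClosed (u '' frontier (ball b δ)) :=
    (isBounded_ball.isCompact_frontier.image hu).isClosed
  have hzero : ∀ y ∈ (u '' frontier (ball b δ))ᶜ,
      topDegree μ (fun x => u x - y) (ball b δ) = 0 := by
    intro y hy
    have hev := eventually_topDegree_sub_eq μ hu isBounded_ball isOpen_ball hy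
    obtain ⟨z, hz, hz1⟩ : ∃ z, topDegree μ (fun x => u x - z) (ball b δ)
        = topDegree μ (fun x => u x - y) (ball b δ) ∧ ‖z‖ ≠ 1 := by
      have hd : Dense {z : E | ‖z‖ ≠ 1} := by
        have : interior (sphere (0 : E) 1) = ∅ := interior_sphere 0 one_ne_zero
        rw [interior_eq_empty_iff_dense_compl] at this
        convert this using 1
        ext z
        simp
      obtain ⟨z, hz1, hz⟩ := hd.exists_mem_open isOpen_interior
        ⟨y, mem_interior_iff_mem_nhds.2 hev⟩
      have hz2 := interior_subset hz
      exact ⟨z, hz2, hz1⟩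
    rw [← hz]
    refine topDegree_sub_eq_zero μ hu isBounded_ball isOpen_ball fun x hx h => hz1 ?_
    rw [← h]
    exact hu1 x (hcl ▸ hx)
  have hcomp := topDegree_comp μ hu (h := fun x => h x - b) (by fun_prop)
    (Ω := ball b δ) (V₀ := (u '' frontier (ball b δ))ᶜ) (V₁ := ∅) isBounded_ball isOpen_ball
    Bornology.isBounded_empty isOpen_empty hcf.isOpen_compl (by simp) (c := 0)
    (fun x hx => by
      simp only [union_empty, mem_compl_iff, not_not]
      exact mem_image_of_mem u hx) (by simp) hzero
    (fun y hy => by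
      left
      rintro ⟨x, hx, rfl⟩
      rw [hfr] at hx
      rw [hinv x (sphere_subset_closedBall hx), sub_eq_zero] at hy
      rw [hy, mem_sphere, dist_self] at hx
      exact hδ.ne hx)
  rw [zero_mul] at hcomp
  have hone := topDegree_sub_const_eq_one μ isBounded_ball isOpen_ball (mem_ball_self (x := b) hδ)
  have heq := topDegree_sub_congr_of_notMem_segment μ (hh.comp hu) continuous_id
    (isBounded_ball (x := b) (r := δ)) isOpen_ball (y := b) (fun x hx hmem => by
      rw [hfr] at hx
      simp only [Function.comp, id, hinv x (sphere_subset_closedBall hx), segment_same,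
        mem_singleton_iff] at hmem
      rw [← hmem, mem_sphere, dist_self] at hx
      exact hδ.ne hx)
  have : (1 : ℝ) = 0 := hone.symm.trans (heq.symm.trans hcomp)
  exact one_ne_zero this

/-- No two distinct bounded regions cut out by `L` and the image of an injective cap can both meet
the complement of a closed convex set containing `L`. -/
theorem not_two_regions {p : E} {c : ℝ} (hc0 : 0 ≤ c)
    {f : sphere (0 : E) 1 → E} (hf : Continuous f) (hinj : InjOn f (sphericalCap p c))
    {L : Set E} (hL : IsClosed L) (hfL : ∀ x ∈ sphericalCap p c, f x ∈ L → ⟪(x : E), p⟫ = c)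
    (hfL' : ∀ x : sphere (0 : E) 1, ⟪(x : E), p⟫ ≤ c → f x ∈ L)
    {Q : Set E} (hQ : Convex ℝ Q) (hQc : IsClosed Q) (hQne : Q.Nonempty) (hLQ : L ⊆ Q)
    {y : Fin 2 → E} (hyQ : ∀ j, y j ∉ Q) (hyf : ∀ j, y j ∉ range f)
    {Δ : Fin 2 → Set E} (hΔ : ∀ i, Bornology.IsBounded (Δ i)) (hΔo : ∀ i, IsOpen (Δ i))
    (hfr : ∀ i, frontier (Δ i) ⊆ L ∪ range f) (hmem : ∀ i, y i ∈ Δ i)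
    (hnot : ∀ i j, i ≠ j → y j ∉ closure (Δ i)) : False := by
  set μ : Measure E := Measure.addHaar
  obtain ⟨g, hg, hgf, hgL⟩ := exists_continuous_local_inverse hc0 hf hinj hL hfL
  have hN := (isClosed_sphericalCap p c).isCompact
  obtain ⟨G, hG, hGf⟩ := hN.exists_continuous_factor
    (f := ((↑) : sphere (0 : E) 1 → E)) continuous_subtype_val.continuousOn
    Subtype.val_injective.injOn hf.continuousOn
  obtain ⟨h, hh, hhG, hhC⟩ := exists_continuous_eqOn_mapsTo
    (hN.image continuous_subtype_val).isClosed (isClosed_cutBall p c) hG hQ hQc hQne (by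
      rintro _ ⟨x, hx, rfl⟩ hxC
      rw [hGf x hx]
      exact hLQ (hfL' x hxC.2))
  have hhf : ∀ x ∈ sphericalCap p c, h x = f x := fun x hx =>
    (hhG (mem_image_of_mem _ hx)).trans (hGf x hx)
  have hfr' : ∀ i, ∀ x ∈ frontier (Δ i), x ∈ L ∨ ∃ t ∈ sphericalCap p c, f t = x := by
    intro i x hx
    rcases hfr i hx with h | ⟨t, rfl⟩
    · exact Or.inl h
    · by_cases ht : t ∈ sphericalCap p c
      · exact Or.inr ⟨t, ht, rfl⟩
      · exact Or.inl (hfL' t (not_le.1 ht).le)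
  have hgc : ∀ i, ∀ x ∈ frontier (Δ i),
      g x ∈ closedBall (0 : E) 1 ∧ g x ∉ openLens p c := by
    intro i x hx
    rcases hfr' i x hx with h | ⟨t, ht, rfl⟩
    · exact ⟨(hgL h).1, notMem_openLens_of_mem_cutBall (hgL h)⟩
    · rw [hgf t ht]
      exact ⟨sphere_subset_closedBall t.2,
        notMem_openLens_of_norm (mem_sphere_zero_iff_norm.1 t.2)⟩
  have hconst : ∀ i, ∃ k : ℝ, ∀ z ∈ openLens p c, topDegree μ (fun x => g x - z) (Δ i) = k := by
    intro i
    rcases (openLens p c).eq_empty_or_nonempty with he | ⟨z₀, hz₀⟩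
    · exact ⟨0, by simp [he]⟩
    · exact ⟨_, fun z hz => topDegree_sub_eq_of_isPreconnected μ hg (hΔ i) (hΔo i)
        (convex_openLens p c).isPreconnected (fun x hx => (hgc i x hx).2) hz hz₀⟩
  choose k hk using hconst
  have hprod : ∀ i j, topDegree μ (fun x => x - y j) (Δ i)
      = k i * topDegree μ (fun x => h x - y j) (openLens p c) := by
    intro i j
    rw [← topDegree_comp μ hg (h := fun x => h x - y j) (by fun_prop) (Ω := Δ i)
      (V₀ := (closedBall 0 1)ᶜ) (V₁ := openLens p c) (hΔ i) (hΔo i) (isBounded_openLens p c)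
      (isOpen_openLens p c) isClosed_closedBall.isOpen_compl
      (disjoint_compl_left_iff_subset.2 (inter_subset_left.trans ball_subset_closedBall))
      (fun x hx => by
        rintro (h | h)
        · exact h (hgc i x hx).1
        · exact (hgc i x hx).2 h) (hk i)
      (fun z hz => topDegree_sub_eq_zero_of_convex μ hg (hΔ i) (hΔo i)
        (convex_closedBall 0 1) (b := 0) (by simp) (fun x hx => (hgc i x hx).1) hz)
      (fun z hz => by
        rw [sub_eq_zero] at hz
        by_contra hzV
        rw [mem_union, not_or, mem_compl_iff, not_not] at hzV
        by_cases hzc : ⟪z, p⟫ ≤ c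
        · exact hyQ j (hz ▸ hhC ⟨hzV.1, hzc⟩)
        · have hz1 : z ∈ sphere (0 : E) 1 := by
            by_contra hzs
            refine hzV.2 ⟨?_, not_le.1 hzc⟩
            rw [mem_ball]
            exact lt_of_le_of_ne hzV.1 hzs
          exact hyf j ⟨⟨z, hz1⟩, by rw [← hz, ← hhf ⟨z, hz1⟩ (not_le.1 hzc).le]⟩)]
    refine (topDegree_sub_congr_of_notMem_segment μ (hh.comp hg) continuous_id (hΔ i) (hΔo i)
      fun x hx hmem => ?_).symm
    simp only [Function.comp, id] at hmem
    rcases hfr' i x hx with h | ⟨t, ht, rfl⟩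
    · exact hyQ j (hQ.segment_subset (hhC (hgL h)) (hLQ h) hmem)
    · rw [hgf t ht, hhf t ht, segment_same, mem_singleton_iff] at hmem
      exact hyf j ⟨t, hmem.symm⟩
  have h00 := hprod 0 0
  have h11 := hprod 1 1
  have h01 := hprod 0 1
  rw [topDegree_sub_const_eq_one μ (hΔ _) (hΔo _) (hmem _)] at h00 h11
  rw [topDegree_sub_eq_zero μ (F := fun x => x) continuous_id (hΔ _) (hΔo _)
    (fun x hx h' => hnot 0 1 (by decide) ((show x = y 1 from h') ▸ hx))] at h01
  rcases mul_eq_zero.1 h01.symm with h | h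
  · rw [h, zero_mul] at h00
    exact one_ne_zero h00
  · rw [h, mul_zero] at h11
    exact one_ne_zero h11

end LocalInverse

section Sphere

theorem real_inner_eq_one_sub_dist_sq {V : Type*} [NormedAddCommGroup V]
    [InnerProductSpace ℝ V] (x y : sphere (0 : V) 1) :
    ⟪(x : V), y⟫ = 1 - dist x y ^ 2 / 2 := by
  have h := norm_sub_sq_real (x : V) y
  rw [mem_sphere_zero_iff_norm.1 x.2, mem_sphere_zero_iff_norm.1 y.2] at h
  rw [Subtype.dist_eq, dist_eq_norm]
  linarith

theorem exists_sphericalCap_subset_ball {V : Type*} [NormedAddCommGroup V]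
    [InnerProductSpace ℝ V] (p : sphere (0 : V) 1) {η : ℝ} (hη : 0 < η) :
    ∃ c : ℝ, 0 ≤ c ∧ c < 1 ∧ sphericalCap (p : V) c ⊆ ball p η := by
  refine ⟨max 0 (1 - η ^ 2 / 4), le_max_left _ _, max_lt one_pos (by nlinarith), fun x hx => ?_⟩
  have h1 : max 0 (1 - η ^ 2 / 4) ≤ ⟪(x : V), p⟫ := hx
  rw [real_inner_eq_one_sub_dist_sq] at h1
  have h2 := (le_max_right _ _).trans h1
  rw [mem_ball]
  exact lt_of_pow_lt_pow_left₀ 2 hη.le (by nlinarith)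

variable {V : Type*} [NormedAddCommGroup V] [InnerProductSpace ℝ V]

theorem exists_stereographic' {m : ℕ} [Fact (Module.finrank ℝ V = m + 1)] (q : sphere (0 : V) 1) :
    ∃ (σ : sphere (0 : V) 1 → EuclideanSpace ℝ (Fin m))
      (π : EuclideanSpace ℝ (Fin m) → sphere (0 : V) 1),
      Continuous π ∧ ContinuousOn σ {q}ᶜ ∧ (∀ s, s ≠ q → π (σ s) = s) ∧ (∀ x, σ (π x) = x) ∧
      (∀ x, π x ≠ q) ∧
      ∀ (a : sphere (0 : V) 1) (δ : ℝ), 0 ≤ δ → q ∈ ball a δ →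
        Convex ℝ {w | δ ≤ dist (π w) a} := by
  set φ := stereographic' m q with hφ
  have hs : φ.source = {q}ᶜ := stereographic'_source q
  have ht : φ.target = univ := stereographic'_target q
  refine ⟨φ, φ.symm, ?_, ?_, ?_, ?_, ?_, ?_⟩
  · rw [← continuousOn_univ, ← ht]
    exact φ.continuousOn_symm
  · exact hs ▸ φ.continuousOn
  · exact fun s h => φ.left_inv (hs ▸ h)
  · exact fun x => φ.right_inv (ht ▸ mem_univ x)
  · intro x
    have := φ.map_target (ht ▸ mem_univ x)
    rwa [hs] at this
  · intro a δ hδ hq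
    obtain ⟨ℓ, hℓ⟩ : ∃ ℓ : EuclideanSpace ℝ (Fin m) →ₗᵢ[ℝ] V, ∀ w, (φ.symm w : V) =
        (‖ℓ w‖ ^ 2 + 4)⁻¹ • (4 : ℝ) • ℓ w + (‖ℓ w‖ ^ 2 + 4)⁻¹ • (‖ℓ w‖ ^ 2 - 4) • (q : V) := by
      have hne : (q : V) ≠ 0 := ne_zero_of_mem_unit_sphere q
      refine ⟨(Submodule.subtypeₗᵢ _).comp
        (OrthonormalBasis.fromOrthogonalSpanSingleton m hne).repr.symm.toLinearIsometry,
        fun w => ?_⟩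
      exact stereographic'_symm_apply q w
    have hq' : 0 ≤ ⟪(q : V), a⟫ - (1 - δ ^ 2 / 2) := by
      rw [real_inner_eq_one_sub_dist_sq]
      have := pow_le_pow_left₀ dist_nonneg (mem_ball.1 hq).le 2
      linarith
    have hset : {w | δ ≤ dist (φ.symm w) a} = {w ∈ univ |
        (⟪(q : V), a⟫ - (1 - δ ^ 2 / 2)) • ‖w‖ ^ 2 + 4 * ⟪ℓ w, (a : V)⟫
          ≤ 4 * (⟪(q : V), a⟫ + (1 - δ ^ 2 / 2))} := by
      ext w
      have h1 := real_inner_eq_one_sub_dist_sq (φ.symm w) a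
      rw [hℓ, ← smul_add, real_inner_smul_left, inner_add_left, real_inner_smul_left,
        real_inner_smul_left, ℓ.norm_map, inv_mul_eq_iff_eq_mul₀ (by positivity)] at h1
      have h2 : δ ≤ dist (φ.symm w) a ↔ δ ^ 2 ≤ dist (φ.symm w) a ^ 2 :=
        (pow_le_pow_iff_left₀ hδ dist_nonneg two_ne_zero).symm
      have h3 : 0 < ‖w‖ ^ 2 + 4 := by positivity
      simp only [mem_ofPred_eq, mem_univ, true_and, smul_eq_mul, h2]
      generalize dist (φ.symm w) a ^ 2 = d at *
      constructor
      · intro h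
        nlinarith
      · intro h
        by_contra! h'
        nlinarith
    rw [hset]
    refine ConvexOn.convex_le ?_ _
    refine ((convexOn_univ_norm.pow (fun _ _ => norm_nonneg _) 2).smul hq').add ?_
    refine ⟨convex_univ, fun x _ y _ s t _ _ _ => le_of_eq ?_⟩
    beta_reduce
    rw [map_add, map_smul, map_smul, inner_add_left, real_inner_smul_left, real_inner_smul_left,
      smul_eq_mul, smul_eq_mul]
    ring

/-- The stereographic chart away from `q` and its inverse; spherical caps whose complement
contains `q` are convex in this chart. -/
theorem exists_stereographic (E : Type*) [NormedAddCommGroup E] [InnerProductSpace ℝ E]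
    [FiniteDimensional ℝ E] [Fact (Module.finrank ℝ V = Module.finrank ℝ E + 1)]
    (q : sphere (0 : V) 1) :
    ∃ (σ : sphere (0 : V) 1 → E) (π : E → sphere (0 : V) 1),
      Continuous π ∧ ContinuousOn σ {q}ᶜ ∧ (∀ s, s ≠ q → π (σ s) = s) ∧ (∀ x, σ (π x) = x) ∧
      (∀ x, π x ≠ q) ∧
      ∀ (a : sphere (0 : V) 1) (δ : ℝ), 0 ≤ δ → q ∈ ball a δ →
        Convex ℝ {w | δ ≤ dist (π w) a} := by
  obtain ⟨σ, π, hπ, hσ, hπσ, hσπ, hπq, hconv⟩ :=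
    exists_stereographic' (m := Module.finrank ℝ E) q
  set e := (stdOrthonormalBasis ℝ E).repr
  refine ⟨e.symm ∘ σ, π ∘ e, hπ.comp e.continuous, e.symm.continuous.comp_continuousOn hσ,
    fun s hs => ?_, fun x => ?_, fun x => hπq _, fun a δ hδ hq => ?_⟩
  · simp [hπσ s hs]
  · simp [hσπ]
  · exact (hconv a δ hδ hq).linear_preimage e.toLinearEquiv.toLinearMap

end Sphere

section Components

theorem disjoint_connectedComponentIn {α : Type*} [TopologicalSpace α] {S : Set α} {x y : α}
    (h : connectedComponentIn S x ≠ connectedComponentIn S y) :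
    Disjoint (connectedComponentIn S x) (connectedComponentIn S y) :=
  disjoint_left.2 fun _ hx hy =>
    h ((connectedComponentIn_eq hx).trans (connectedComponentIn_eq hy).symm)

variable {α : Type*} [TopologicalSpace α] [LocallyConnectedSpace α]

theorem disjoint_closure_connectedComponentIn {S : Set α} (hS : IsOpen S) {x y : α}
    (h : connectedComponentIn S x ≠ connectedComponentIn S y) :
    Disjoint (closure (connectedComponentIn S x)) (connectedComponentIn S y) :=
  (disjoint_connectedComponentIn h).closure_left hS.connectedComponentIn

theorem frontier_connectedComponentIn_subset {S : Set α} (hS : IsOpen S) (x : α) :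
    frontier (connectedComponentIn S x) ⊆ Sᶜ := by
  intro z hz hzS
  rw [hS.connectedComponentIn.frontier_eq] at hz
  by_cases h : connectedComponentIn S x = connectedComponentIn S z
  · exact hz.2 (h ▸ mem_connectedComponentIn hzS)
  · exact disjoint_left.1 (disjoint_closure_connectedComponentIn hS h) hz.1
      (mem_connectedComponentIn hzS)

end Components

section Cap

variable {E V : Type*} [NormedAddCommGroup E] [InnerProductSpace ℝ E] [FiniteDimensional ℝ E]
  [NormedAddCommGroup V] [InnerProductSpace ℝ V]

variable {f : sphere (0 : E) 1 → sphere (0 : V) 1} (hf : Continuous f)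
  {p : sphere (0 : E) 1} {c ε : ℝ}

include hf

omit [InnerProductSpace ℝ V] in
theorem isClosed_image_le (p : E) (c : ℝ) : IsClosed (f '' {x | ⟪(x : E), p⟫ ≤ c}) := by
  have h : IsClosed {x : sphere (0 : E) 1 | ⟪(x : E), p⟫ ≤ c} :=
    isClosed_le (by fun_prop) continuous_const
  exact (h.isCompact.image hf).isClosed

omit [InnerProductSpace ℝ V] in
theorem exists_ball_disjoint_image_le (hc1 : c < 1)
    (hinj : ∀ x ∈ sphericalCap (p : E) c, ∀ y, f y = f x → y = x) :
    ∃ δ > 0, Disjoint (ball (f p) δ) (f '' {x | ⟪(x : E), p⟫ ≤ c}) := by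
  have hpp : ⟪(p : E), p⟫ = 1 := by rw [real_inner_eq_one_sub_dist_sq]; simp
  have hp : f p ∈ (f '' {x | ⟪(x : E), p⟫ ≤ c})ᶜ := by
    rintro ⟨x, hx, hxp⟩
    rw [hinj p (show c ≤ _ by rw [hpp]; exact hc1.le) x hxp] at hx
    have hx' : ⟪(p : E), p⟫ ≤ c := hx
    linarith
  obtain ⟨δ, hδ, h⟩ := Metric.isOpen_iff.1 (isClosed_image_le hf p c).isOpen_compl _ hp
  exact ⟨δ, hδ, disjoint_left.2 h⟩

variable [Nontrivial E] [MeasurableSpace E] [BorelSpace E]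
  [Fact (Module.finrank ℝ V = Module.finrank ℝ E + 1)]

/-- The image of a sphere of one dimension less has no interior point near an injective cap. -/
theorem not_ball_subset_range (hc1 : c < 1)
    (hinj : ∀ x ∈ sphericalCap (p : E) c, ∀ y, f y = f x → y = x) (hε : 0 < ε) :
    ¬ ball (f p) ε ⊆ range f := by
  intro hsub
  obtain ⟨δ₀, hδ₀, hdisj⟩ := exists_ball_disjoint_image_le hf hc1 hinj
  obtain ⟨ρ, hρ, hρε, hρδ, hρ1⟩ : ∃ ρ > 0, ρ < ε ∧ ρ < δ₀ ∧ ρ < 1 := by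
    obtain ⟨ρ, h1, h2⟩ := exists_between (lt_min (lt_min hε hδ₀) one_pos)
    simp only [lt_min_iff] at h2
    exact ⟨ρ, h1, h2.1.1, h2.1.2, h2.2⟩
  obtain ⟨σ, π, hπ, hσ, hπσ, hσπ, hπq, -⟩ := exists_stereographic E (-f p)
  have hq : -f p ∉ closedBall (f p) ρ := by
    rw [mem_closedBall, Subtype.dist_eq, dist_eq_norm]
    have : ((-f p : sphere (0 : V) 1) : V) - f p = (-2 : ℝ) • (f p : V) := by
      rw [coe_neg_sphere]
      module
    rw [this, norm_smul, mem_sphere_zero_iff_norm.1 (f p).2]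
    norm_num
    linarith
  set K : Set (sphere (0 : E) 1) := sphericalCap (p : E) c ∩ f ⁻¹' closedBall (f p) ρ with hK
  have hKc : IsCompact K :=
    ((isClosed_sphericalCap _ _).inter (isClosed_closedBall.preimage hf)).isCompact
  obtain ⟨u, hu, huf⟩ := hKc.exists_continuous_factor hf.continuousOn
    (fun x hx y hy h => hinj y hy.1 x h) (u := ((↑) : sphere (0 : E) 1 → E))
    continuous_subtype_val.continuousOn
  obtain ⟨h, hh, hhf⟩ := hKc.exists_continuous_factor (f := ((↑) : sphere (0 : E) 1 → E))
    continuous_subtype_val.continuousOn Subtype.val_injective.injOn (u := fun x => σ (f x))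
    (hσ.comp hf.continuousOn fun x hx h => hq (h ▸ hx.2))
  have hne : f p ≠ -f p := fun h => hq (h ▸ mem_closedBall_self hρ.le)
  have hnhds : π ⁻¹' ball (f p) ρ ∈ 𝓝 (σ (f p)) :=
    hπ.continuousAt.preimage_mem_nhds (by rw [hπσ _ hne]; exact ball_mem_nhds _ hρ)
  obtain ⟨δ, hδ, hδb⟩ := nhds_basis_closedBall.mem_iff.1 hnhds
  have key : ∀ x ∈ closedBall (σ (f p)) δ, ∃ t ∈ K, f t = π x := by
    intro x hx
    have hx' : π x ∈ ball (f p) ρ := hδb hx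
    obtain ⟨t, ht⟩ := hsub (ball_subset_ball hρε.le hx')
    refine ⟨t, ⟨?_, by rw [mem_preimage, ht]; exact ball_subset_closedBall hx'⟩, ht⟩
    by_contra htc
    exact disjoint_left.1 hdisj (ball_subset_ball hρδ.le hx')
      (ht ▸ mem_image_of_mem f (show ⟪(t : E), p⟫ ≤ c from le_of_not_ge htc))
  refine not_exists_leftInverse_sphere (hu.comp hπ) hh (σ (f p)) hδ (fun x hx => ?_)
    fun x hx => ?_
  · obtain ⟨t, ht, htx⟩ := key x hx
    rw [Function.comp, ← htx, huf t ht]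
    exact mem_sphere_zero_iff_norm.1 t.2
  · obtain ⟨t, ht, htx⟩ := key x hx
    rw [Function.comp, ← htx, huf t ht, hhf t ht, htx, hσπ]

/-- Near an injective cap, the image of the sphere separates. -/
theorem exists_notMem_connectedComponentIn (hc0 : 0 ≤ c) (hc1 : c < 1)
    (hinj : ∀ x ∈ sphericalCap (p : E) c, ∀ y, f y = f x → y = x)
    (hcap : MapsTo f (sphericalCap (p : E) c) (ball (f p) ε)) {q : sphere (0 : V) 1}
    (hq : q ∉ range f) :
    ∃ y ∈ ball (f p) ε \ range f, y ∉ connectedComponentIn (range f)ᶜ q := by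
  obtain ⟨σ, π, hπ, hσ, hπσ, hσπ, hπq, -⟩ := exists_stereographic E q
  have hfq : ∀ x, f x ≠ q := fun x h => hq ⟨x, h⟩
  have hσf : Continuous fun x => σ (f x) := hσ.comp_continuous hf hfq
  set μ : Measure E := Measure.addHaar
  obtain ⟨F, hF, hFf⟩ := isCompact_univ.exists_continuous_factor
    (f := ((↑) : sphere (0 : E) 1 → E)) continuous_subtype_val.continuousOn
    Subtype.val_injective.injOn hσf.continuousOn
  replace hFf := fun x => hFf x (mem_univ x)
  have hL : IsClosed (π ⁻¹' (f '' {x | ⟪(x : E), p⟫ ≤ c} ∪ (ball (f p) ε)ᶜ)) :=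
    ((isClosed_image_le hf p c).union isOpen_ball.isClosed_compl).preimage hπ
  obtain ⟨y, hyL, hyf, hy0⟩ := exists_topDegree_ne_zero μ (mem_sphere_zero_iff_norm.1 p.2)
    hc0 hc1 hσf (fun x hx y hy h => hinj y hy x (by
      rw [← hπσ _ (hfq x), ← hπσ _ (hfq y)]
      exact congrArg π h)) hL
    (fun x hx hxL => by
      rw [mem_preimage, hπσ _ (hfq x)] at hxL
      rcases hxL with ⟨t, ht, htx⟩ | h
      · rw [hinj x hx t htx] at ht
        exact le_antisymm ht hx
      · exact absurd (hcap hx) h)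
    (fun x hx => by
      rw [mem_preimage, hπσ _ (hfq x)]
      exact Or.inl (mem_image_of_mem f (show ⟪(x : E), p⟫ ≤ c from le_of_not_ge hx))) hF hFf
  rw [mem_preimage, mem_union, not_or, mem_compl_iff, not_not] at hyL
  refine ⟨π y, ⟨hyL.2, fun ⟨x, hx⟩ => hyf ⟨x, ?_⟩⟩, fun hyC => hy0 ?_⟩
  · simp only [hx, hσπ]
  classical
  set w : sphere (0 : V) 1 → ℝ := fun s =>
    if s = q then 0 else topDegree μ (fun x => F x - σ s) (ball 0 1) with hw
  have hfr : frontier (ball (0 : E) 1) = sphere 0 1 := frontier_ball _ one_ne_zero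
  have hloc : ∀ s ∈ (range f)ᶜ, ∀ᶠ t in 𝓝 s, w t = w s := by
    intro s hs
    by_cases hsq : s = q
    · subst hsq
      obtain ⟨R, hR⟩ := ((isCompact_closedBall (0 : E) 1).image hF).isBounded.subset_closedBall 0
      have hc : IsClosed (π '' closedBall 0 R) :=
        ((isCompact_closedBall (0 : E) R).image hπ).isClosed
      filter_upwards [hc.isOpen_compl.mem_nhds (fun ⟨x, _, hx⟩ => hπq x hx)] with t ht
      by_cases hts : t = s
      · rw [hts]
      · simp only [hw, hts, if_false, if_true]
        refine topDegree_sub_eq_zero μ hF isBounded_ball isOpen_ball fun x hx h => ht ?_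
        refine ⟨σ t, ?_, hπσ t hts⟩
        rw [← h]
        exact hR (mem_image_of_mem F (closure_ball_subset_closedBall hx))
    · have h1 := eventually_topDegree_sub_eq μ hF (isBounded_ball (x := (0 : E)) (r := 1))
        isOpen_ball (y := σ s) (by
          rintro ⟨x, hx, hxs⟩
          rw [hfr] at hx
          refine hs ⟨⟨x, hx⟩, ?_⟩
          rw [← hπσ _ (hfq ⟨x, hx⟩), ← hFf, hxs, hπσ s hsq])
      have h2 : ContinuousAt σ s := hσ.continuousAt (isOpen_compl_singleton.mem_nhds hsq)
      filter_upwards [h2.eventually h1, isOpen_compl_singleton.mem_nhds hsq] with t ht htq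
      have htq' : t ≠ q := htq
      simp only [hw, hsq, htq', if_false]
      exact ht
  have hpre := (isPreconnected_connectedComponentIn (F := (range f)ᶜ) (x := q)).induction₂
    (fun s t => w s = w t)
    (fun s hs => mem_nhdsWithin_of_mem_nhds <| by
      filter_upwards [hloc s (connectedComponentIn_subset _ _ hs)] with t ht
      exact ht.symm)
    (fun _ _ _ _ _ _ h1 h2 => h1.trans h2) (fun _ _ _ _ h => h.symm) hyC
    (mem_connectedComponentIn hq)
  simpa only [hw, hπq, if_false, if_true, hσπ] using hpre

/-- Near an injective cap, the image of the sphere separates into at most two pieces. -/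
theorem exists_ball_connectedComponentIn_eq (hc0 : 0 ≤ c) (hc1 : c < 1)
    (hinj : ∀ x ∈ sphericalCap (p : E) c, ∀ y, f y = f x → y = x)
    (hcap : MapsTo f (sphericalCap (p : E) c) (ball (f p) ε)) (hε : 0 < ε) :
    ∃ δ > 0, δ ≤ ε ∧ ∀ q ∈ ball (f p) δ \ range f, ∀ y : Fin 2 → sphere (0 : V) 1,
      (∀ i, y i ∈ ball (f p) δ \ range f) →
      (∀ i, connectedComponentIn (ball (f p) ε \ range f) (y i) ≠
        connectedComponentIn (ball (f p) ε \ range f) q) →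
      connectedComponentIn (ball (f p) ε \ range f) (y 0) =
        connectedComponentIn (ball (f p) ε \ range f) (y 1) := by
  have hfin : FiniteDimensional ℝ V :=
    FiniteDimensional.of_fact_finrank_eq_succ (Module.finrank ℝ E)
  have hloc : LocallyConnectedSpace (sphere (0 : V) 1) :=
    ChartedSpace.locallyConnectedSpace (EuclideanSpace ℝ (Fin (Module.finrank ℝ E))) _
  obtain ⟨δ₀, hδ₀, hdisj⟩ := exists_ball_disjoint_image_le hf hc1 hinj
  set S := ball (f p) ε \ range f with hS
  have hSo : IsOpen S := isOpen_ball.sdiff (isCompact_range hf).isClosed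
  refine ⟨min δ₀ ε, lt_min hδ₀ hε, min_le_right _ _, fun q hq y hy hyq => ?_⟩
  by_contra hne
  have hsub : ball (f p) (min δ₀ ε) \ range f ⊆ S :=
    sdiff_subset_sdiff_left (ball_subset_ball (min_le_right _ _))
  obtain ⟨σ, π, hπ, hσ, hπσ, hσπ, hπq, hconv⟩ := exists_stereographic E q
  have hfq : ∀ x, f x ≠ q := fun x h => hq.2 ⟨x, h⟩
  have hσf : Continuous fun x => σ (f x) := hσ.comp_continuous hf hfq
  have hyne : ∀ i, y i ≠ q := fun i h => hyq i (by rw [h])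
  have hL : IsClosed (π ⁻¹' (f '' {x | ⟪(x : E), p⟫ ≤ c} ∪ (ball (f p) ε)ᶜ)) :=
    ((isClosed_image_le hf p c).union isOpen_ball.isClosed_compl).preimage hπ
  have hLQ : π ⁻¹' (f '' {x | ⟪(x : E), p⟫ ≤ c} ∪ (ball (f p) ε)ᶜ) ⊆
      {w | min δ₀ ε ≤ dist (π w) (f p)} := by
    intro w hw
    by_contra! hlt
    have hlt' : dist (π w) (f p) < min δ₀ ε := not_le.1 hlt
    rw [lt_min_iff] at hlt'
    rcases hw with h | h
    · exact disjoint_left.1 hdisj hlt'.1 h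
    · exact h hlt'.2
  have hmemL : ∀ x : sphere (0 : E) 1, ⟪(x : E), p⟫ ≤ c →
      σ (f x) ∈ π ⁻¹' (f '' {x | ⟪(x : E), p⟫ ≤ c} ∪ (ball (f p) ε)ᶜ) := fun x hx => by
    rw [mem_preimage, hπσ _ (hfq x)]
    exact Or.inl ⟨x, hx, rfl⟩
  have hdis : ∀ i j, i ≠ j →
      connectedComponentIn S (y i) ≠ connectedComponentIn S (y j) := by
    intro i j hij
    fin_cases i <;> fin_cases j
    · exact absurd rfl hij
    · exact hne
    · exact fun h => hne h.symm
    · exact absurd rfl hij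
  refine not_two_regions (p := (p : E)) hc0 hσf (fun x hx y hy h => hinj y hy x (by
      rw [← hπσ _ (hfq x), ← hπσ _ (hfq y)]
      exact congrArg π h)) hL
    (fun x hx hxL => by
      rw [mem_preimage, hπσ _ (hfq x)] at hxL
      rcases hxL with ⟨t, ht, htx⟩ | h
      · rw [hinj x hx t htx] at ht
        exact le_antisymm ht hx
      · exact absurd (hcap hx) h) hmemL
    (hconv (f p) _ (lt_min hδ₀ hε).le hq.1)
    (isClosed_le continuous_const (hπ.dist continuous_const)) ?_ hLQ
    (y := fun j => σ (y j)) (Δ := fun i => π ⁻¹' connectedComponentIn S (y i)) ?_ ?_ ?_ ?_ ?_ ?_ ?_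
  · refine ⟨_, hLQ (hmemL (-p) ?_)⟩
    rw [coe_neg_sphere, inner_neg_left, real_inner_eq_one_sub_dist_sq, dist_self]
    norm_num
    linarith
  · intro j h
    have h' : min δ₀ ε ≤ dist (π (σ (y j))) (f p) := h
    rw [hπσ _ (hyne j)] at h'
    exact not_lt.2 h' (hy j).1
  · rintro j ⟨x, hx⟩
    refine (hy j).2 ⟨x, ?_⟩
    rw [← hπσ _ (hfq x), ← hπσ _ (hyne j)]
    exact congrArg π hx
  · intro i
    have hC : IsCompact (connectedComponentIn S q)ᶜ :=
      hSo.connectedComponentIn.isClosed_compl.isCompact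
    refine (hC.image_of_continuousOn (hσ.mono ?_)).isBounded.subset fun x hx =>
      ⟨π x, fun h => ?_, hσπ x⟩
    · intro s hs h
      rw [mem_singleton_iff] at h
      exact hs (h.symm ▸ mem_connectedComponentIn (hsub hq))
    · exact disjoint_left.1 (disjoint_connectedComponentIn (hyq i)) hx h
  · exact fun i => hSo.connectedComponentIn.preimage hπ
  · intro i x hx
    have h := frontier_connectedComponentIn_subset hSo _ (hπ.frontier_preimage_subset _ hx)
    rw [hS, mem_compl_iff, Set.mem_sdiff, not_and_not_right] at h
    by_cases hb : π x ∈ ball (f p) ε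
    · obtain ⟨t, ht⟩ := h hb
      exact Or.inr ⟨t, by simp only [ht, hσπ]⟩
    · exact Or.inl (Or.inr hb)
  · intro i
    rw [mem_preimage, hπσ _ (hyne i)]
    exact mem_connectedComponentIn (hsub (hy i))
  · intro i j hij h
    have h' := hπ.closure_preimage_subset _ h
    rw [mem_preimage, hπσ _ (hyne j)] at h'
    exact disjoint_left.1 (disjoint_closure_connectedComponentIn hSo (hdis i j hij)) h'
      (mem_connectedComponentIn (hsub (hy j)))

end Cap

section Germ

variable {α : Type*} [PseudoMetricSpace α] {K : Set α} {a : α}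

theorem mem_closure_connectedComponentIn_of_germ
    (h₁ : ∀ ε > 0, ∃ x ∈ ball a ε \ K, ∃ y ∈ ball a ε \ K, y ∉ connectedComponentIn Kᶜ x)
    {ε δ : ℝ} (hδ : 0 < δ) (hδε : δ ≤ ε) {z w : α}
    (h : ∀ q ∈ ball a δ \ K,
      connectedComponentIn (ball a ε \ K) q = connectedComponentIn (ball a ε \ K) z ∨
      connectedComponentIn (ball a ε \ K) q = connectedComponentIn (ball a ε \ K) w) :
    a ∈ closure (connectedComponentIn (ball a ε \ K) z) := by
  rw [Metric.mem_closure_iff]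
  by_contra! hc
  obtain ⟨ρ, hρ, hρz⟩ := hc
  have hS : ∀ q ∈ ball a (min ρ δ) \ K, q ∈ ball a ε \ K := fun q hq =>
    ⟨ball_subset_ball ((min_le_right _ _).trans hδε) hq.1, hq.2⟩
  have hw : ∀ q ∈ ball a (min ρ δ) \ K,
      connectedComponentIn (ball a ε \ K) q = connectedComponentIn (ball a ε \ K) w := by
    intro q hq
    refine (h q ⟨ball_subset_ball (min_le_right _ _) hq.1, hq.2⟩).resolve_left fun hqz => ?_
    have h2 := hρz q (hqz ▸ mem_connectedComponentIn (hS q hq))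
    have h3 := (mem_ball'.1 hq.1).trans_le (min_le_left ρ δ)
    linarith
  obtain ⟨x, hx, y, hy, hxy⟩ := h₁ _ (lt_min hρ hδ)
  refine hxy (connectedComponentIn_mono x (show ball a ε \ K ⊆ Kᶜ from fun _ h => h.2) ?_)
  rw [hw x hx, ← hw y hy]
  exact mem_connectedComponentIn (hS y hy)

/-- If the complement of `K` has at least two and at most two components near `a`, then exactly
two components of each punctured ball are adherent to `a`. -/
theorem exists_two_isConnCompIn
    (h₁ : ∀ ε > 0, ∃ x ∈ ball a ε \ K, ∃ y ∈ ball a ε \ K, y ∉ connectedComponentIn Kᶜ x)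
    {ε δ : ℝ} (hδ : 0 < δ) (hδε : δ ≤ ε)
    (h₂ : ∀ q ∈ ball a δ \ K, ∀ y : Fin 2 → α, (∀ i, y i ∈ ball a δ \ K) →
      (∀ i, connectedComponentIn (ball a ε \ K) (y i) ≠ connectedComponentIn (ball a ε \ K) q) →
      connectedComponentIn (ball a ε \ K) (y 0) = connectedComponentIn (ball a ε \ K) (y 1)) :
    ∃ C₁ C₂ : Set α, C₁ ≠ C₂ ∧ IsConnCompIn (ball a ε \ K) C₁ ∧ IsConnCompIn (ball a ε \ K) C₂ ∧
      a ∈ closure C₁ ∧ a ∈ closure C₂ ∧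
      ∀ C, IsConnCompIn (ball a ε \ K) C → a ∈ closure C → C = C₁ ∨ C = C₂ := by
  obtain ⟨x, hx, y, hy, hxy⟩ := h₁ δ hδ
  have hS : ∀ q ∈ ball a δ \ K, q ∈ ball a ε \ K := fun q hq =>
    ⟨ball_subset_ball hδε hq.1, hq.2⟩
  have hne : connectedComponentIn (ball a ε \ K) x ≠ connectedComponentIn (ball a ε \ K) y := by
    intro h
    refine hxy (connectedComponentIn_mono x (show ball a ε \ K ⊆ Kᶜ from fun _ h => h.2) ?_)
    rw [h]
    exact mem_connectedComponentIn (hS y hy)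
  have hall : ∀ q ∈ ball a δ \ K,
      connectedComponentIn (ball a ε \ K) q = connectedComponentIn (ball a ε \ K) x ∨
      connectedComponentIn (ball a ε \ K) q = connectedComponentIn (ball a ε \ K) y := by
    intro q hq
    by_contra! h
    refine hne (h₂ q hq ![x, y] ?_ ?_)
    · rw [Fin.forall_fin_two]
      exact ⟨hx, hy⟩
    · rw [Fin.forall_fin_two]
      exact ⟨h.1.symm, h.2.symm⟩
  refine ⟨_, _, hne, ⟨x, hS x hx, rfl⟩, ⟨y, hS y hy, rfl⟩,
    mem_closure_connectedComponentIn_of_germ h₁ hδ hδε hall,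
    mem_closure_connectedComponentIn_of_germ h₁ hδ hδε fun q hq => (hall q hq).symm, ?_⟩
  rintro _ ⟨z, hz, rfl⟩ haz
  obtain ⟨q, hq, haq⟩ := Metric.mem_closure_iff.1 haz δ hδ
  rw [connectedComponentIn_eq hq]
  exact hall q ⟨mem_ball'.2 haq, (connectedComponentIn_subset _ _ hq).2⟩

end Germ

section Main

variable {E V : Type*} [NormedAddCommGroup E] [InnerProductSpace ℝ E] [FiniteDimensional ℝ E]
  [NormedAddCommGroup V] [InnerProductSpace ℝ V] [Nontrivial E] [MeasurableSpace E] [BorelSpace E]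
  [Fact (Module.finrank ℝ V = Module.finrank ℝ E + 1)]

/-- A point of a codimension-one sphere with a neighbourhood of injectivity is adherent to
exactly two local components of the complement. -/
theorem exists_two_isConnCompIn_of_injective_near {f : sphere (0 : E) 1 → sphere (0 : V) 1}
    (hf : Continuous f) {p : sphere (0 : E) 1} {s : ℝ} (hs : 0 < s)
    (hinj : ∀ x ∈ ball p s, ∀ y, f y = f x → y = x) {ε : ℝ} (hε : 0 < ε) :
    ∃ C₁ C₂ : Set (sphere (0 : V) 1), C₁ ≠ C₂ ∧
      IsConnCompIn (ball (f p) ε \ range f) C₁ ∧ IsConnCompIn (ball (f p) ε \ range f) C₂ ∧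
      f p ∈ closure C₁ ∧ f p ∈ closure C₂ ∧
      ∀ C, IsConnCompIn (ball (f p) ε \ range f) C → f p ∈ closure C → C = C₁ ∨ C = C₂ := by
  have hcap : ∀ ε > 0, ∃ c : ℝ, 0 ≤ c ∧ c < 1 ∧
      (∀ x ∈ sphericalCap (p : E) c, ∀ y, f y = f x → y = x) ∧
      MapsTo f (sphericalCap (p : E) c) (ball (f p) ε) := by
    intro ε hε
    obtain ⟨η, hη, hηf⟩ := Metric.continuousAt_iff.1 hf.continuousAt ε hε
    obtain ⟨c, hc0, hc1, hc⟩ := exists_sphericalCap_subset_ball p (lt_min hs hη)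
    exact ⟨c, hc0, hc1, fun x hx => hinj x (ball_subset_ball (min_le_left _ _) (hc hx)),
      fun x hx => hηf (ball_subset_ball (min_le_right _ _) (hc hx))⟩
  obtain ⟨c, hc0, hc1, hci, hcm⟩ := hcap ε hε
  obtain ⟨δ, hδ, hδε, h₂⟩ := exists_ball_connectedComponentIn_eq hf hc0 hc1 hci hcm hε
  refine exists_two_isConnCompIn (fun ε' hε' => ?_) hδ hδε h₂
  obtain ⟨c, hc0, hc1, hci, hcm⟩ := hcap ε' hε'
  obtain ⟨q, hqb, hq⟩ := not_subset.1 (not_ball_subset_range hf hc1 hci hε')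
  exact ⟨q, ⟨hqb, hq⟩, exists_notMem_connectedComponentIn hf hc0 hc1 hci hcm hq⟩

end Main

end Auxiliary

/-- Let `n ≥ 1` and let `f : Sⁿ → Sⁿ⁺¹` be a continuous map whose set of
injectivity contains the closed metric ball `D` of radius `0 < r < 1` about `x₀ ∈ Sⁿ`.
Then for every `p ∈ D°` and every `ε > 0`, there are precisely two connected components of
`B(f(p), ε) \ f(Sⁿ)` which contain `f(p)` in their closure. -/
theorem two_local_components_at_injective_point
    (n : ℕ) (hn : 1 ≤ n)
    (f : (Metric.sphere (0 : EuclideanSpace ℝ (Fin (n + 1))) 1) →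
         (Metric.sphere (0 : EuclideanSpace ℝ (Fin (n + 2))) 1))
    (hf : Continuous f)
    (x₀ : Metric.sphere (0 : EuclideanSpace ℝ (Fin (n + 1))) 1)
    (r : ℝ) (hr0 : 0 < r) (hr1 : r < 1)
    (hinj : ∀ p, dist p x₀ ≤ r → ∀ q, f q = f p → q = p)
    (p : Metric.sphere (0 : EuclideanSpace ℝ (Fin (n + 1))) 1)
    (hp : dist p x₀ < r)
    (ε : ℝ) (hε : 0 < ε) :
    ∃ C₁ C₂ : Set (Metric.sphere (0 : EuclideanSpace ℝ (Fin (n + 2))) 1),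
      C₁ ≠ C₂ ∧
      IsConnCompIn (Metric.ball (f p) ε \ Set.range f) C₁ ∧
      IsConnCompIn (Metric.ball (f p) ε \ Set.range f) C₂ ∧
      f p ∈ closure C₁ ∧ f p ∈ closure C₂ ∧
      ∀ C, IsConnCompIn (Metric.ball (f p) ε \ Set.range f) C →
        f p ∈ closure C → C = C₁ ∨ C = C₂ := by
  have hfact : Fact (Module.finrank ℝ (EuclideanSpace ℝ (Fin (n + 2)))
      = Module.finrank ℝ (EuclideanSpace ℝ (Fin (n + 1))) + 1) := ⟨by simp⟩
  refine exists_two_isConnCompIn_of_injective_near hf (sub_pos.2 hp) (fun x hx => hinj x ?_) hε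
  have h := dist_triangle x p x₀
  have hx' := Metric.mem_ball.1 hx
  linarith
end
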